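/- arXiv:2402.12909 — 3 statements merged into one kernel-verified Lean document; each statement's English description precedes it below -/
import Mathlib

section
/- (Picard-type theorem for Weierstrass m-triples) Let (Σ, f dz, g) be a Weierstrass m-triple. If the metric ds² = (1+|g|²)^m |f|² |dz|² is complete on Σ and g is nonconstant on Σ, then g can omit at most m + 2 distinct values in Ĉ. -/
open Filter Set MeasureTheory Topology
open scoped ENNReal

noncomputable section

/-- Half of the chordal (spherical) distance on the Riemann sphere `OnePoint ℂ`. -/
def sphDist : OnePoint ℂ → OnePoint ℂ → ℝ
  | OnePoint.infty, OnePoint.infty => 0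
  | OnePoint.infty, (w : ℂ) => 1 / Real.sqrt (1 + ‖w‖ ^ 2)
  | (z : ℂ), OnePoint.infty => 1 / Real.sqrt (1 + ‖z‖ ^ 2)
  | (z : ℂ), (w : ℂ) => ‖z - w‖ / (Real.sqrt (1 + ‖z‖ ^ 2) * Real.sqrt (1 + ‖w‖ ^ 2))

/-- A map `f : ℂ → Ĉ` is holomorphic on `U` if near each point of `U` it is, in the chart,
either a coerced holomorphic function or the reciprocal of a holomorphic function. -/
def SphHolomorphicOn (f : ℂ → OnePoint ℂ) (U : Set ℂ) : Prop :=
  ∀ z ∈ U, ∃ V : Set ℂ, IsOpen V ∧ z ∈ V ∧ ∃ h : ℂ → ℂ, DifferentiableOn ℂ h V ∧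
    ((∀ w ∈ V, f w = (h w : OnePoint ℂ)) ∨
     (∀ w ∈ V, f w = if h w = 0 then OnePoint.infty else (((h w)⁻¹ : ℂ) : OnePoint ℂ)))

/-- Locally uniform convergence on `U` with respect to the spherical distance. -/
def SphLocUnifOn (F : ℕ → ℂ → OnePoint ℂ) (f : ℂ → OnePoint ℂ) (U : Set ℂ) : Prop :=
  ∀ K : Set ℂ, K ⊆ U → IsCompact K → ∀ ε > (0:ℝ),
    ∀ᶠ n in Filter.atTop, ∀ z ∈ K, sphDist (F n z) (f z) < ε

/-- Locally uniform convergence of real-valued functions on `U`. -/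
def RealLocUnifOn (F : ℕ → ℂ → ℝ) (f : ℂ → ℝ) (U : Set ℂ) : Prop :=
  ∀ K : Set ℂ, K ⊆ U → IsCompact K → ∀ ε > (0:ℝ),
    ∀ᶠ n in Filter.atTop, ∀ z ∈ K, |F n z - f z| < ε

/-- A closed property for holomorphic maps into the Riemann sphere (on plane domains). -/
structure IsClosedProperty (P : Set ℂ → (ℂ → OnePoint ℂ) → Prop) : Prop where
  mem_holo : ∀ (U : Set ℂ) (f : ℂ → OnePoint ℂ), IsOpen U → IsConnected U →
    P U f → SphHolomorphicOn f U
  /-- (P1): stability under precomposition with unramified holomorphic maps. -/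
  comp : ∀ (U V : Set ℂ) (φ : ℂ → ℂ) (f : ℂ → OnePoint ℂ),
    IsOpen U → IsConnected U → IsOpen V → IsConnected V →
    DifferentiableOn ℂ φ U → Set.MapsTo φ U V → (∀ z ∈ U, deriv φ z ≠ 0) →
    P V f → P U (f ∘ φ)
  /-- (P2): if `f` has the property on every relatively compact subdomain, it has it globally. -/
  exhaust : ∀ (U : Set ℂ) (f : ℂ → OnePoint ℂ), IsOpen U → IsConnected U →
    SphHolomorphicOn f U →
    (∀ Ω : Set ℂ, IsOpen Ω → IsConnected Ω → IsCompact (closure Ω) → closure Ω ⊆ U → P Ω f) →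
    P U f
  /-- (P3): `𝒫(U)` is closed under locally uniform spherical convergence in `𝑀(U)`. -/
  closed : ∀ (U : Set ℂ) (f : ℂ → OnePoint ℂ) (F : ℕ → ℂ → OnePoint ℂ),
    IsOpen U → IsConnected U → (∀ n, P U (F n)) → SphLocUnifOn F f U →
    SphHolomorphicOn f U → P U f

/-- A compact property: a closed property all of whose families `𝒫(U)` are normal. -/
structure IsCompactProperty (P : Set ℂ → (ℂ → OnePoint ℂ) → Prop) extends
    IsClosedProperty P : Prop where
  /-- (P4): normality of `𝒫(U)` for every domain `U`. -/
  normal : ∀ (U : Set ℂ), IsOpen U → IsConnected U →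
    ∀ F : ℕ → ℂ → OnePoint ℂ, (∀ n, P U (F n)) →
      ∃ φ : ℕ → ℕ, StrictMono φ ∧ ∃ g : ℂ → OnePoint ℂ, SphLocUnifOn (F ∘ φ) g U

/-- The spherical derivative of a map into the Riemann sphere (limit of spherical
difference quotients). For `f` meromorphic near `z` this equals `|f'|/(1+|f|²)`. -/
def sphD (f : ℂ → OnePoint ℂ) (z : ℂ) : ℝ :=
  limUnder (𝓝[≠] z) (fun w => sphDist (f w) (f z) / ‖w - z‖)

/-- A Weierstrass `m`-triple on a plane domain `U`: a holomorphic `1`-form `f dz`, a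
meromorphic function `g`, and the (continuous positive) conformal density `lam` of the
metric `ds² = (1+|g|²)^m |f|² |dz|²`. -/
structure WeierstrassTriple (m : ℕ) (U : Set ℂ) where
  isOpen : IsOpen U
  isConnected : IsConnected U
  f : ℂ → ℂ
  g : ℂ → OnePoint ℂ
  f_holo : DifferentiableOn ℂ f U
  g_holo : SphHolomorphicOn g U
  g_mero : ∃ z ∈ U, g z ≠ OnePoint.infty
  lam : ℂ → ℝ
  lam_cont : ContinuousOn lam U
  lam_pos : ∀ z ∈ U, 0 < lam z
  lam_eq : ∀ z ∈ U, ∀ w : ℂ, g z = (w : OnePoint ℂ) →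
    lam z = (1 + ‖w‖ ^ 2) ^ ((m : ℝ) / 2) * ‖f z‖

/-- The Gaussian curvature `K = -2m |g'|²/((1+|g|²)^{m+2}|f|²)` of a Weierstrass
`m`-triple, written via the spherical derivative: `K = -2m (g^#)² / λ²`. -/
def WeierstrassTriple.curv {m : ℕ} {U : Set ℂ} (T : WeierstrassTriple m U) (z : ℂ) : ℝ :=
  -(2 * m) * (sphD T.g z) ^ 2 / (T.lam z) ^ 2

/-- A divergent `C¹` path in `U` starting at `p`, parametrized by `[0,1)`. -/
structure DivergentPath (U : Set ℂ) (p : ℂ) where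
  toFun : ℝ → ℂ
  start : toFun 0 = p
  mem : ∀ t ∈ Set.Ico (0:ℝ) 1, toFun t ∈ U
  cont : ContinuousOn toFun (Set.Ico (0:ℝ) 1)
  diff : ∀ t ∈ Set.Ioo (0:ℝ) 1, DifferentiableAt ℝ toFun t
  divergent : ∀ K : Set ℂ, IsCompact K → K ⊆ U →
    ∃ t₀ ∈ Set.Ico (0:ℝ) 1, ∀ t, t₀ ≤ t → t < 1 → toFun t ∉ K

/-- The length of a path with respect to the conformal metric with density `lam`. -/
def pathLen (lam : ℂ → ℝ) (γ : ℝ → ℂ) : ℝ≥0∞ :=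
  ∫⁻ t in Set.Ioo (0:ℝ) 1, ENNReal.ofReal (lam (γ t) * ‖deriv γ t‖)

/-- The geodesic distance from `p` to the boundary of `U`: the infimum of lengths of
divergent paths starting at `p`. -/
def distToBdry (lam : ℂ → ℝ) (U : Set ℂ) (p : ℂ) : ℝ≥0∞ :=
  ⨅ γ : DivergentPath U p, pathLen lam γ.toFun

/-- Completeness of the conformal metric with density `lam` on `U`: every divergent path
has infinite length. -/
def IsCompleteMetric (lam : ℂ → ℝ) (U : Set ℂ) : Prop :=
  ∀ p ∈ U, ∀ γ : DivergentPath U p, pathLen lam γ.toFun = ⊤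

/-- The property `P_L`: `|f| < L` on `U`, or `f` is constant on `U`. -/
def PL (L : ℝ) (U : Set ℂ) (f : ℂ → OnePoint ℂ) : Prop :=
  SphHolomorphicOn f U ∧
    ((∀ z ∈ U, ∃ w : ℂ, f z = (w : OnePoint ℂ) ∧ ‖w‖ < L) ∨
      (∀ z ∈ U, ∀ w ∈ U, f z = f w))

/-- The property `P_X`: `f` omits every value of `X`, or `f` is constant on `U`. -/
def PX (X : Set (OnePoint ℂ)) (U : Set ℂ) (f : ℂ → OnePoint ℂ) : Prop :=
  SphHolomorphicOn f U ∧ ((∀ z ∈ U, f z ∉ X) ∨ (∀ z ∈ U, ∀ w ∈ U, f z = f w))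

/-- Second directional derivative of `u : ℂ → ℝ` at `z` in direction `v`. -/
def dirDeriv2 (u : ℂ → ℝ) (z v : ℂ) : ℝ :=
  deriv (deriv (fun t : ℝ => u (z + t • v))) 0

/-- The Euclidean Laplacian of `u : ℂ → ℝ`. -/
def laplacian (u : ℂ → ℝ) (z : ℂ) : ℝ :=
  dirDeriv2 u z 1 + dirDeriv2 u z Complex.I


/-- A compact property `P` satisfies the `m`-curvature estimate if there is `C > 0` such
that `|K| d² ≤ C` for every Weierstrass `m`-triple whose meromorphic function satisfies `P`. -/
def SatisfiesCurvatureEstimate (P : Set ℂ → (ℂ → OnePoint ℂ) → Prop) (m : ℕ) : Prop :=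
  ∃ C : ℝ, 0 < C ∧ ∀ (U : Set ℂ) (T : WeierstrassTriple m U), P U T.g →
    ∀ p ∈ U, ENNReal.ofReal |T.curv p| * (distToBdry T.lam U p) ^ 2 ≤ ENNReal.ofReal C

theorem exists_hasDerivAt_exp_eq_on_ball {R : ℝ} (hR : 0 < R) {f : ℂ → ℂ}
    (hf : DifferentiableOn ℂ f (Metric.ball 0 R)) (h0 : ∀ z ∈ Metric.ball (0 : ℂ) R, f z ≠ 0) :
    ∃ l : ℂ → ℂ, l 0 = Complex.log (f 0) ∧ DifferentiableOn ℂ l (Metric.ball 0 R) ∧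
      ∀ z ∈ Metric.ball (0 : ℂ) R, Complex.exp (l z) = f z := by
  have hd : DifferentiableOn ℂ (fun z => deriv f z / f z) (Metric.ball 0 R) :=
    (hf.deriv Metric.isOpen_ball).div hf h0
  obtain ⟨l, hl0, hl⟩ := hd.isExactOn_ball.with_val_at 0 (Complex.log (f 0))
  have hmem : (0 : ℂ) ∈ Metric.ball (0 : ℂ) R := Metric.mem_ball_self hR
  refine ⟨l, hl0, fun z hz => (hl z hz).differentiableAt.differentiableWithinAt, fun z hz => ?_⟩
  have key : ∀ w ∈ Metric.ball (0 : ℂ) R,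
      HasDerivAt (fun w => f w * Complex.exp (-l w)) 0 w := by
    intro w hw
    have h1 := (hf.differentiableAt (Metric.isOpen_ball.mem_nhds hw)).hasDerivAt
    convert! h1.mul ((hl w hw).neg.cexp) using 1
    have := h0 w hw
    field_simp
    ring
  have hc := Metric.isOpen_ball.is_const_of_deriv_eq_zero
    (convex_ball (0 : ℂ) R).isPreconnected
    (fun w hw => (key w hw).differentiableAt.differentiableWithinAt)
    (fun w hw => (key w hw).deriv) hz hmem
  simp only [hl0, Complex.exp_neg, Complex.exp_log (h0 0 hmem), mul_inv_cancel₀ (h0 0 hmem)] at hc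
  have := mul_inv_eq_one₀ (Complex.exp_ne_zero (l z)) |>.1 hc
  exact this.symm

theorem ball_subset_image_of_norm_deriv_le {F : ℂ → ℂ} {a : ℂ} {t : ℝ} (ht : 0 < t)
    (hF : ∀ z ∈ Metric.ball a t, DifferentiableAt ℂ F z) (h0 : deriv F a ≠ 0)
    (hb : ∀ z ∈ Metric.ball a t, ‖deriv F z‖ ≤ 2 * ‖deriv F a‖) :
    Metric.ball (F a) (‖deriv F a‖ * t / 24) ⊆ F '' Metric.ball a t := by
  have hFd : DifferentiableOn ℂ F (Metric.ball a t) :=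
    fun z hz => (hF z hz).differentiableWithinAt
  have hF' := hFd.deriv Metric.isOpen_ball
  have hpos : 0 < ‖deriv F a‖ := norm_pos_iff.2 h0
  have hmaps : MapsTo (deriv F) (Metric.ball a t)
      (Metric.closedBall (deriv F a) (3 * ‖deriv F a‖)) := by
    intro z hz
    rw [mem_closedBall_iff_norm]
    calc _ ≤ ‖deriv F z‖ + ‖deriv F a‖ := norm_sub_le _ _
      _ ≤ _ := by linarith [hb z hz]
  have hsub : Metric.closedBall a (t / 6) ⊆ Metric.ball a t :=
    Metric.closedBall_subset_ball (by linarith)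
  have hclose : ∀ z ∈ Metric.closedBall a (t / 6), ‖deriv F z - deriv F a‖ ≤ ‖deriv F a‖ / 2 := by
    intro z hz
    have := Complex.dist_le_div_mul_dist_of_mapsTo_ball hF' hmaps (hsub hz)
    rw [dist_eq_norm] at this
    refine this.trans ?_
    rw [Metric.mem_closedBall] at hz
    calc 3 * ‖deriv F a‖ / t * dist z a ≤ 3 * ‖deriv F a‖ / t * (t / 6) := by gcongr
      _ = _ := by field_simp; norm_num
  have hlin : ∀ z ∈ Metric.closedBall a (t / 6),
      ‖(F z - deriv F a * z) - (F a - deriv F a * a)‖ ≤ ‖deriv F a‖ / 2 * ‖z - a‖ := by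
    intro z hz
    refine (convex_closedBall a (t / 6)).norm_image_sub_le_of_norm_hasDerivWithin_le
      (f := fun z => F z - deriv F a * z) (f' := fun z => deriv F z - deriv F a * 1) ?_ ?_
      (Metric.mem_closedBall_self (by linarith)) hz
    · intro x hx
      exact ((hF x (hsub hx)).hasDerivAt.sub
        ((hasDerivAt_id x).const_mul _)).hasDerivWithinAt
    · intro x hx
      simpa using hclose x hx
  have hsph : ∀ z ∈ Metric.sphere a (t / 6), ‖deriv F a‖ * t / 12 ≤ ‖F z - F a‖ := by
    intro z hz
    have h1 := hlin z (Metric.sphere_subset_closedBall hz)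
    rw [mem_sphere_iff_norm] at hz
    have h2 : ‖deriv F a * (z - a)‖ ≤
        ‖F z - F a‖ + ‖(F z - deriv F a * z) - (F a - deriv F a * a)‖ := by
      refine le_trans (le_of_eq ?_) (norm_sub_le _ _)
      congr 1
      ring
    rw [norm_mul, hz] at h2
    rw [hz] at h1
    linarith
  have hdc : DiffContOnCl ℂ F (Metric.ball a (t / 6)) :=
    (hFd.mono hsub).diffContOnCl_ball subset_rfl
  have hfreq : ∃ᶠ z in 𝓝 a, F z ≠ F a := by
    intro h
    apply h0
    have : F =ᶠ[𝓝 a] fun _ => F a := by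
      filter_upwards [h] with z hz
      simpa using hz
    rw [this.deriv_eq]
    simp
  have := hdc.ball_subset_image_closedBall (by linarith) hsph hfreq
  rw [show ‖deriv F a‖ * t / 12 / 2 = ‖deriv F a‖ * t / 24 by ring] at this
  exact this.trans (image_mono hsub)

/-- A form of Bloch's theorem: a holomorphic function on a disc whose omitted values are
`10`-dense in the plane has derivative at the center controlled by the radius. -/
theorem norm_deriv_mul_le_of_omits_net {F : ℂ → ℂ} {R : ℝ}
    (hF : DifferentiableOn ℂ F (Metric.ball 0 R))
    (hN : ∀ ζ : ℂ, ∃ ξ : ℂ, dist ξ ζ ≤ 10 ∧ ∀ z ∈ Metric.ball (0 : ℂ) R, F z ≠ ξ) :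
    ‖deriv F 0‖ * R ≤ 480 := by
  have main : ∀ r : ℝ, 0 < r → r < R → ‖deriv F 0‖ * r ≤ 480 := by
    intro r hr hrR
    by_contra! hcon
    have hsub : Metric.closedBall (0 : ℂ) r ⊆ Metric.ball 0 R :=
      Metric.closedBall_subset_ball hrR
    have hcont : ContinuousOn (fun z => ‖deriv F z‖ * (r - ‖z‖)) (Metric.closedBall 0 r) :=
      (((hF.deriv Metric.isOpen_ball).continuousOn.mono hsub).norm).mul (by fun_prop)
    obtain ⟨a, ha, hmax⟩ := (isCompact_closedBall (0 : ℂ) r).exists_isMaxOn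
      ⟨0, Metric.mem_closedBall_self hr.le⟩ hcont
    have hmax' : ∀ z, ‖z‖ ≤ r → ‖deriv F z‖ * (r - ‖z‖) ≤ ‖deriv F a‖ * (r - ‖a‖) :=
      fun z hz => hmax (by simpa using hz)
    have h0 := hmax' 0 (by simpa using hr.le)
    rw [norm_zero, sub_zero] at h0
    have ha' : ‖a‖ ≤ r := by simpa using ha
    have hprod : 480 < ‖deriv F a‖ * (r - ‖a‖) := by linarith
    have hra : 0 < r - ‖a‖ := by
      rcases (sub_nonneg.2 ha').eq_or_lt with h | h
      · rw [← h] at hprod; norm_num at hprod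
      · exact h
    have hda : deriv F a ≠ 0 := by
      intro h
      rw [h] at hprod; norm_num at hprod
    set t := (r - ‖a‖) / 2 with ht
    have hbt : ∀ z ∈ Metric.ball a t, ‖z‖ ≤ r ∧ t ≤ r - ‖z‖ := by
      intro z hz
      rw [mem_ball_iff_norm] at hz
      have := norm_le_norm_add_norm_sub a z
      rw [norm_sub_rev] at this
      constructor <;> linarith
    have htpos : 0 < t := by linarith
    have himg := ball_subset_image_of_norm_deriv_le htpos
      (fun z hz => hF.differentiableAt (Metric.isOpen_ball.mem_nhds
        (hsub (by simpa using (hbt z hz).1)))) hda (by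
        intro z hz
        have h1 := hmax' z (hbt z hz).1
        have h2 : ‖deriv F z‖ * t ≤ ‖deriv F z‖ * (r - ‖z‖) := by
          gcongr; exact (hbt z hz).2
        have h3 : ‖deriv F z‖ * t ≤ (2 * ‖deriv F a‖) * t := by
          rw [ht] at h2 ⊢; linarith
        exact le_of_mul_le_mul_right h3 htpos)
    obtain ⟨ξ, hξ, hom⟩ := hN (F a)
    have : ξ ∈ Metric.ball (F a) (‖deriv F a‖ * t / 24) := by
      rw [Metric.mem_ball]
      refine lt_of_le_of_lt hξ ?_
      rw [ht]; linarith
    obtain ⟨z, hz, hzξ⟩ := himg this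
    exact hom z (hsub (by simpa using (hbt z hz).1)) hzξ
  rcases le_or_gt R 0 with hR | hR
  · have := mul_nonpos_of_nonneg_of_nonpos (norm_nonneg (deriv F 0)) hR
    linarith
  · by_contra! hcon
    have hpos : 0 < ‖deriv F 0‖ := by
      by_contra! h
      have := mul_nonpos_of_nonpos_of_nonneg h hR.le
      linarith
    have h1 := main (480 / ‖deriv F 0‖ / 2 + R / 2) (by positivity) (by
      have : 480 / ‖deriv F 0‖ < R := by rw [div_lt_iff₀ hpos]; linarith
      linarith)
    have h2 : ‖deriv F 0‖ * (480 / ‖deriv F 0‖ / 2 + R / 2) = 240 + ‖deriv F 0‖ * R / 2 := by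
      field_simp
      norm_num
    linarith

theorem exists_cosh_eq_odd_near (ζ : ℂ) :
    ∃ ξ : ℂ, dist ξ ζ ≤ 10 ∧ ∃ n : ℤ, Complex.cosh ξ = 2 * n + 1 := by
  set N : ℕ := 2 * ⌈Real.cosh ζ.re / 2⌉₊ + 1 with hN
  have hc : 1 ≤ Real.cosh ζ.re := Real.one_le_cosh _
  have hN1 : Real.cosh ζ.re ≤ N := by
    have := Nat.le_ceil (Real.cosh ζ.re / 2)
    rw [hN]; push_cast; linarith
  have hN2 : (N : ℝ) ≤ Real.cosh ζ.re + 3 := by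
    have := (Nat.ceil_lt_add_one (a := Real.cosh ζ.re / 2) (by linarith)).le
    rw [hN]; push_cast; linarith
  have h1N : (1 : ℝ) ≤ N := hc.trans hN1
  set a := Real.arcosh N with ha
  have hca : Real.cosh a = N := Real.cosh_arcosh h1N
  have ha0 : 0 ≤ a := Real.arcosh_nonneg h1N
  have hax : |ζ.re| ≤ a := by
    rw [← hca, Real.cosh_le_cosh, abs_of_nonneg ha0] at hN1
    exact hN1
  have hax' : a ≤ |ζ.re| + 3 := by
    have h1 : Real.exp a ≤ 2 * N := by
      rw [← hca, Real.cosh_eq]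
      linarith [Real.exp_pos (-a)]
    have h2 : Real.cosh ζ.re ≤ Real.exp |ζ.re| := by
      rw [← Real.cosh_abs, Real.cosh_eq]
      have : Real.exp (-|ζ.re|) ≤ Real.exp |ζ.re| :=
        Real.exp_le_exp.2 (by linarith [abs_nonneg ζ.re])
      linarith
    have h3 : 1 ≤ Real.exp |ζ.re| := Real.one_le_exp (abs_nonneg _)
    have h4 : 8 ≤ Real.exp 3 := by
      have h5 : (2 : ℝ) ≤ Real.exp 1 := by linarith [Real.add_one_le_exp (1 : ℝ)]
      calc (8 : ℝ) = 2 ^ 3 := by norm_num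
        _ ≤ Real.exp 1 ^ 3 := by gcongr
        _ = Real.exp 3 := by rw [← Real.exp_nat_mul]; norm_num
    rw [← Real.exp_le_exp, Real.exp_add]
    nlinarith
  obtain ⟨b, hb, hcb⟩ : ∃ b : ℝ, |b - ζ.re| ≤ 3 ∧ Real.cosh b = N := by
    rcases le_total 0 ζ.re with h | h
    · rw [abs_of_nonneg h] at hax hax'
      exact ⟨a, by rw [abs_le]; constructor <;> linarith, hca⟩
    · rw [abs_of_nonpos h] at hax hax'
      exact ⟨-a, by rw [abs_le]; constructor <;> linarith, by rw [Real.cosh_neg, hca]⟩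
  set k : ℤ := round (ζ.im / Real.pi) with hk
  have hkd : |(k : ℝ) * Real.pi - ζ.im| ≤ 2 := by
    have h1 := abs_sub_round (ζ.im / Real.pi)
    rw [← hk] at h1
    have h2 : (k : ℝ) * Real.pi - ζ.im = -((ζ.im / Real.pi - k) * Real.pi) := by
      field_simp
      ring
    rw [h2, abs_neg, abs_mul, abs_of_pos Real.pi_pos]
    nlinarith [Real.pi_lt_four, Real.pi_pos]
  refine ⟨b + (k * Real.pi : ℝ) * Complex.I, ?_, ?_⟩
  · rw [dist_eq_norm]
    refine (Complex.norm_le_abs_re_add_abs_im _).trans ?_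
    simp only [Complex.sub_re, Complex.add_re, Complex.ofReal_re, Complex.re_ofReal_mul,
      Complex.I_re, mul_zero, add_zero, Complex.sub_im, Complex.add_im, Complex.ofReal_im,
      Complex.im_ofReal_mul, Complex.I_im, mul_one, zero_add]
    linarith
  · have hcosh : Complex.cosh (b + (k * Real.pi : ℝ) * Complex.I) = N * (-1) ^ k := by
      rw [Complex.cosh_add, Complex.cosh_mul_I, Complex.sinh_mul_I, ← Complex.ofReal_cos,
        ← Complex.ofReal_sin, Real.sin_int_mul_pi, Real.cos_int_mul_pi, ← Complex.ofReal_cosh, hcb]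
      simp
    rw [hcosh]
    rcases Int.even_or_odd k with h | h
    · refine ⟨⌈Real.cosh ζ.re / 2⌉₊, ?_⟩
      rw [h.neg_one_zpow, hN]
      push_cast
      ring
    · refine ⟨-⌈Real.cosh ζ.re / 2⌉₊ - 1, ?_⟩
      rw [h.neg_one_zpow, hN]
      push_cast
      ring

/-- A quantitative form of Landau's theorem for functions omitting `0` and `1`. -/
theorem landau_zero_one {G : ℂ → ℂ} {R : ℝ} (hR : 0 < R)
    (hG : DifferentiableOn ℂ G (Metric.ball 0 R)) (h0 : ∀ z ∈ Metric.ball (0 : ℂ) R, G z ≠ 0)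
    (h1 : ∀ z ∈ Metric.ball (0 : ℂ) R, G z ≠ 1) :
    ‖deriv G 0‖ * R ≤ 3840 * ‖G 0‖ * (1 + |Real.log ‖G 0‖|) := by
  have hmem : (0 : ℂ) ∈ Metric.ball (0 : ℂ) R := Metric.mem_ball_self hR
  have hnhds := Metric.isOpen_ball.mem_nhds hmem
  have hpi : (Real.pi : ℂ) ≠ 0 := by exact_mod_cast Real.pi_ne_zero
  have hpiI : (Real.pi : ℂ) * Complex.I ≠ 0 := mul_ne_zero hpi Complex.I_ne_zero
  obtain ⟨l, hl0, hld, hl⟩ := exists_hasDerivAt_exp_eq_on_ball hR hG.neg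
    (fun z hz => neg_ne_zero.2 (h0 z hz))
  set K : ℂ → ℂ := fun z => l z / (Real.pi * Complex.I) with hK
  have hKd : DifferentiableOn ℂ K (Metric.ball 0 R) := hld.div_const _
  have hKodd : ∀ z ∈ Metric.ball (0 : ℂ) R, ∀ n : ℤ, K z ≠ 2 * n + 1 := by
    intro z hz n hn
    have h2 : l z = n * (2 * Real.pi * Complex.I) + Real.pi * Complex.I := by
      rw [hK] at hn
      rw [div_eq_iff hpiI] at hn
      rw [hn]; ring
    have h3 := hl z hz
    rw [h2, Complex.exp_add, Complex.exp_int_mul_two_pi_mul_I, Complex.exp_pi_mul_I, one_mul] at h3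
    exact h1 z hz (neg_injective h3).symm
  have hK1 : ∀ z ∈ Metric.ball (0 : ℂ) R, K z ^ 2 - 1 ≠ 0 := by
    intro z hz h
    have h2 : (K z - 1) * (K z + 1) = 0 := by rw [← h]; ring
    rcases mul_eq_zero.1 h2 with h3 | h3
    · exact hKodd z hz 0 (by push_cast; linear_combination h3)
    · exact hKodd z hz (-1) (by push_cast; linear_combination h3)
  obtain ⟨q, -, hqd, hq⟩ := exists_hasDerivAt_exp_eq_on_ball hR
    ((hKd.pow 2).sub_const 1) hK1
  set v : ℂ → ℂ := fun z => Complex.exp (q z / 2) with hv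
  have hvd : DifferentiableOn ℂ v (Metric.ball 0 R) := (hqd.div_const 2).cexp
  have hv2 : ∀ z ∈ Metric.ball (0 : ℂ) R, v z ^ 2 = K z ^ 2 - 1 := by
    intro z hz
    rw [hv, ← Complex.exp_nat_mul]
    refine Eq.trans ?_ (hq z hz)
    congr 1
    push_cast
    ring
  have hprod : ∀ z ∈ Metric.ball (0 : ℂ) R, (K z + v z) * (K z - v z) = 1 := by
    intro z hz
    linear_combination -(hv2 z hz)
  obtain ⟨M, -, hMd, hM⟩ := exists_hasDerivAt_exp_eq_on_ball hR (hKd.add hvd)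
    (fun z hz => left_ne_zero_of_mul_eq_one (hprod z hz))
  have hMneg : ∀ z ∈ Metric.ball (0 : ℂ) R, Complex.exp (-M z) = K z - v z := by
    intro z hz
    rw [Complex.exp_neg, hM z hz]
    exact inv_eq_of_mul_eq_one_right (hprod z hz)
  have hcosh : ∀ z ∈ Metric.ball (0 : ℂ) R, Complex.cosh (M z) = K z := by
    intro z hz
    rw [Complex.cosh, hM z hz, hMneg z hz, Pi.add_apply]
    ring
  have hsinh : Complex.sinh (M 0) = v 0 := by
    rw [Complex.sinh, hM 0 hmem, hMneg 0 hmem, Pi.add_apply]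
    ring
  have hbloch : ‖deriv M 0‖ * R ≤ 480 := by
    refine norm_deriv_mul_le_of_omits_net hMd fun ζ => ?_
    obtain ⟨ξ, hξ, n, hn⟩ := exists_cosh_eq_odd_near ζ
    exact ⟨ξ, hξ, fun z hz h => hKodd z hz n (by rw [← hcosh z hz, h, hn])⟩
  have hK' : deriv K 0 = v 0 * deriv M 0 := by
    have h2 : K =ᶠ[𝓝 0] fun z => Complex.cosh (M z) := by
      filter_upwards [hnhds] with z hz
      exact (hcosh z hz).symm
    rw [h2.deriv_eq, ((hMd.differentiableAt hnhds).hasDerivAt.ccosh).deriv, hsinh]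
  have hl' : deriv l 0 = Real.pi * Complex.I * deriv K 0 := by
    rw [hK, deriv_div_const]
    field_simp
  have hG' : deriv G 0 = G 0 * deriv l 0 := by
    have h2 : G =ᶠ[𝓝 0] fun z => -Complex.exp (l z) := by
      filter_upwards [hnhds] with z hz
      rw [hl z hz, Pi.neg_apply, neg_neg]
    have h3 := hl 0 hmem
    rw [Pi.neg_apply] at h3
    rw [h2.deriv_eq, ((hld.differentiableAt hnhds).hasDerivAt.cexp.fun_neg).deriv, h3]
    ring
  have hv0 : ‖v 0‖ ≤ ‖K 0‖ + 1 := by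
    have h2 : ‖v 0‖ ^ 2 ≤ (‖K 0‖ + 1) ^ 2 := by
      rw [← norm_pow, hv2 0 hmem]
      refine (norm_sub_le _ _).trans ?_
      rw [norm_pow, norm_one]
      nlinarith [norm_nonneg (K 0)]
    exact le_of_sq_le_sq h2 (by positivity)
  have hKl : Real.pi * ‖K 0‖ = ‖l 0‖ := by
    rw [hK]
    simp only [norm_div, norm_mul, Complex.norm_I, mul_one, Complex.norm_real, Real.norm_eq_abs,
      abs_of_pos Real.pi_pos]
    field_simp
  have hl0' : ‖l 0‖ ≤ |Real.log ‖G 0‖| + Real.pi := by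
    rw [hl0]
    refine (Complex.norm_le_abs_re_add_abs_im _).trans ?_
    rw [Complex.log_re, Complex.log_im, Pi.neg_apply, norm_neg]
    gcongr
    exact Complex.abs_arg_le_pi _
  have hnl : ‖deriv l 0‖ * R ≤ 480 * (‖l 0‖ + Real.pi) := by
    rw [hl', hK']
    simp only [norm_mul, Complex.norm_I, mul_one, Complex.norm_real, Real.norm_eq_abs,
      abs_of_pos Real.pi_pos]
    calc Real.pi * (‖v 0‖ * ‖deriv M 0‖) * R = Real.pi * ‖v 0‖ * (‖deriv M 0‖ * R) := by ring
      _ ≤ Real.pi * (‖K 0‖ + 1) * 480 := by gcongr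
      _ = 480 * (‖l 0‖ + Real.pi) := by rw [← hKl]; ring
  rw [hG', norm_mul]
  calc ‖G 0‖ * ‖deriv l 0‖ * R = ‖G 0‖ * (‖deriv l 0‖ * R) := by ring
    _ ≤ ‖G 0‖ * (480 * (‖l 0‖ + Real.pi)) := by gcongr
    _ ≤ ‖G 0‖ * (3840 * (1 + |Real.log ‖G 0‖|)) := by
      refine mul_le_mul_of_nonneg_left ?_ (norm_nonneg _)
      linarith [Real.pi_lt_four, abs_nonneg (Real.log ‖G 0‖)]
    _ = _ := by ring

theorem one_add_abs_log_pow_le (m : ℕ) {y M : ℝ} (hy : 0 < y) (h1 : y ≤ M) (h2 : y⁻¹ ≤ M) :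
    (1 + |Real.log y|) ^ (m * (m + 4)) ≤ (m + 5 : ℝ) ^ (m * (m + 4)) * M ^ m := by
  have hM : 0 < M := hy.trans_le h1
  have hM1 : 1 ≤ M := by
    rcases le_total 1 y with h | h
    · exact h.trans h1
    · exact (one_le_inv_iff₀.2 ⟨hy, h⟩).trans h2
  have hlog : |Real.log y| ≤ Real.log M := by
    rw [abs_le]
    constructor
    · have := Real.log_le_log (inv_pos.2 hy) h2
      rw [Real.log_inv] at this
      linarith
    · exact Real.log_le_log hy h1
  set ε : ℝ := 1 / (m + 4) with hε
  have hεpos : 0 < ε := by positivity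
  have h3 : Real.log M ≤ M ^ ε * (m + 4) := by
    have := Real.log_le_rpow_div hM.le hεpos
    rwa [hε, div_div_eq_mul_div, div_one, ← hε] at this
  have h4 : 1 ≤ M ^ ε := Real.one_le_rpow hM1 hεpos.le
  have h5 : 1 + |Real.log y| ≤ (m + 5) * M ^ ε := by linarith
  have h6 : (M ^ ε) ^ (m * (m + 4)) = M ^ m := by
    rw [← Real.rpow_natCast, ← Real.rpow_mul hM.le, ← Real.rpow_natCast M m]
    congr 1
    rw [hε]; push_cast
    field_simp
  calc _ ≤ ((m + 5) * M ^ ε) ^ (m * (m + 4)) := by gcongr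
    _ = _ := by rw [mul_pow, h6]

theorem landau_pair {G : ℂ → ℂ} {R : ℝ} (hR : 0 < R) {α β : ℂ} (hαβ : β ≠ α)
    (hG : DifferentiableOn ℂ G (Metric.ball 0 R)) (h0 : ∀ z ∈ Metric.ball (0 : ℂ) R, G z ≠ α)
    (h1 : ∀ z ∈ Metric.ball (0 : ℂ) R, G z ≠ β) :
    ‖deriv G 0‖ * R ≤
      3840 * ‖G 0 - α‖ * (1 + |Real.log (‖G 0 - α‖ / ‖β - α‖)|) := by
  have hsub : β - α ≠ 0 := sub_ne_zero.2 hαβ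
  have hn : 0 < ‖β - α‖ := norm_pos_iff.2 hsub
  have := landau_zero_one hR (G := fun z => (G z - α) / (β - α)) ((hG.sub_const α).div_const _)
    (fun z hz => div_ne_zero (sub_ne_zero.2 (h0 z hz)) hsub)
    (fun z hz h => h1 z hz (by
      rw [div_eq_one_iff_eq hsub] at h
      exact sub_left_injective h))
  rw [deriv_div_const, deriv_sub_const, norm_div, norm_div] at this
  calc ‖deriv G 0‖ * R = ‖deriv G 0‖ / ‖β - α‖ * R * ‖β - α‖ := by field_simp
    _ ≤ 3840 * (‖G 0 - α‖ / ‖β - α‖) * (1 + |Real.log (‖G 0 - α‖ / ‖β - α‖)|) * ‖β - α‖ := by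
      gcongr
    _ = _ := by field_simp

/-- The Landau-type estimate for functions omitting `m + 2` finite values, weighted so as to be
compatible with the metric `(1 + |g|²)^m |f|² |dz|²`. -/
theorem exists_weighted_landau (m : ℕ) (A : Finset ℂ) (hA : A.card = m + 2) :
    ∃ B : ℝ, 0 < B ∧ ∀ (R : ℝ) (G : ℂ → ℂ), 0 < R → DifferentiableOn ℂ G (Metric.ball 0 R) →
      (∀ z ∈ Metric.ball (0 : ℂ) R, G z ∉ A) →
      (‖deriv G 0‖ * R) ^ (m * (m + 4)) * (1 + ‖G 0‖) ^ (m * (1 + m * (m + 4))) ≤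
        B * ∏ α ∈ A, ‖G 0 - α‖ ^ (m * (m + 3)) := by
  classical
  obtain ⟨L, hL1, hL⟩ : ∃ L : ℝ, 1 ≤ L ∧ ∀ α ∈ A, ‖α‖ ≤ L := by
    obtain ⟨L, hL⟩ := A.finite_toSet.isBounded.exists_norm_le
    exact ⟨max 1 L, le_max_left _ _, fun α hα => (hL α hα).trans (le_max_right _ _)⟩
  obtain ⟨δ, hδ, hsep⟩ : ∃ δ : ℝ, 0 < δ ∧ ∀ α ∈ A, ∀ β ∈ A, β ≠ α → δ ≤ ‖β - α‖ := by
    have hne : A.offDiag.Nonempty := by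
      obtain ⟨α, hα, β, hβ, h⟩ := Finset.one_lt_card.1 (show 1 < A.card by omega)
      exact ⟨(α, β), by simp [hα, hβ, h]⟩
    obtain ⟨p, hp, hmin⟩ := A.offDiag.exists_min_image (fun p => ‖p.2 - p.1‖) hne
    rw [Finset.mem_offDiag] at hp
    refine ⟨‖p.2 - p.1‖, norm_pos_iff.2 (sub_ne_zero.2 (Ne.symm hp.2.2)), fun α hα β hβ h => ?_⟩
    exact hmin (α, β) (by simp [hα, hβ, Ne.symm h])
  set E : ℝ := 2 * (1 + L) / δ + 1 with hE
  set M₀ : ℝ := L ^ 2 / δ + 2 * L with hM₀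
  have hEpos : 0 < E := by positivity
  have hM₀pos : 0 < M₀ := by positivity
  refine ⟨3840 ^ (m * (m + 4)) * (m + 5 : ℝ) ^ (m * (m + 4)) * M₀ ^ m *
    E ^ ((m + 1) * (m * (m + 3))), by positivity, fun R G hR hG hom => ?_⟩
  have hmem : (0 : ℂ) ∈ Metric.ball (0 : ℂ) R := Metric.mem_ball_self hR
  obtain ⟨α, hα, hnear⟩ := A.exists_min_image (fun α => ‖G 0 - α‖)
    (Finset.card_pos.1 (by omega))
  obtain ⟨β, hβ, hβα⟩ := Finset.exists_mem_ne (show 1 < A.card by omega) α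
  have hfar : ∀ γ ∈ A.erase α, 1 + ‖G 0‖ ≤ E * ‖G 0 - γ‖ := by
    intro γ hγ
    rw [Finset.mem_erase] at hγ
    have h1 : δ ≤ ‖γ - α‖ := hsep α hα γ hγ.2 hγ.1
    have h2 : ‖γ - α‖ ≤ ‖G 0 - α‖ + ‖G 0 - γ‖ := by
      refine le_trans (le_of_eq ?_) (norm_sub_le _ _)
      congr 1; ring
    have h3 := hnear γ hγ.2
    have h4 : 1 ≤ 2 / δ * ‖G 0 - γ‖ := by
      rw [div_mul_eq_mul_div, le_div_iff₀ hδ]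
      linarith
    have h5 : ‖G 0‖ ≤ ‖γ‖ + ‖G 0 - γ‖ := by
      refine le_trans (le_of_eq ?_) (norm_add_le _ _)
      congr 1; ring
    have h6 := hL γ hγ.2
    calc 1 + ‖G 0‖ ≤ (1 + L) * 1 + ‖G 0 - γ‖ := by linarith
      _ ≤ (1 + L) * (2 / δ * ‖G 0 - γ‖) + ‖G 0 - γ‖ := by gcongr
      _ = _ := by rw [hE]; ring
  set d : ℝ := ‖G 0 - α‖ with hd
  set W : ℝ := 1 + ‖G 0‖ with hW
  have hW1 : 1 ≤ W := by linarith [norm_nonneg (G 0)]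
  have hdpos : 0 < d := norm_pos_iff.2 (sub_ne_zero.2 fun h => hom 0 hmem (h ▸ hα))
  have hβpos : 0 < ‖β - α‖ := norm_pos_iff.2 (sub_ne_zero.2 hβα)
  have hdW : d ≤ L * W := by
    have h1 : d ≤ ‖G 0‖ + ‖α‖ := norm_sub_le _ _
    have h2 := hL α hα
    rw [hW]
    nlinarith [norm_nonneg (G 0)]
  have hlandau := landau_pair hR hβα hG (fun z hz h => hom z hz (h ▸ hα))
    (fun z hz h => hom z hz (h ▸ hβ))
  rw [← hd] at hlandau
  have hlog := one_add_abs_log_pow_le m (y := d / ‖β - α‖) (M := M₀ * W ^ 2 / d) (by positivity)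
    (by
      rw [div_le_div_iff₀ hβpos hdpos]
      calc d * d ≤ (L * W) * (L * W) := by gcongr
        _ = L ^ 2 / δ * W ^ 2 * δ := by field_simp
        _ ≤ M₀ * W ^ 2 * ‖β - α‖ := by
          gcongr
          · rw [hM₀]; linarith
          · exact hsep α hα β hβ hβα)
    (by
      rw [inv_div]
      gcongr
      have h1 : ‖β - α‖ ≤ ‖β‖ + ‖α‖ := norm_sub_le _ _
      have h2 := hL α hα
      have h3 := hL β hβ
      have h4 : 0 ≤ L ^ 2 / δ := by positivity
      calc ‖β - α‖ ≤ M₀ * 1 := by rw [hM₀]; linarith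
        _ ≤ M₀ * W ^ 2 := by gcongr; exact one_le_pow₀ hW1)
  have hprod : W ^ ((m + 1) * (m * (m + 3))) ≤
      E ^ ((m + 1) * (m * (m + 3))) * ∏ γ ∈ A.erase α, ‖G 0 - γ‖ ^ (m * (m + 3)) := by
    have hcard : (A.erase α).card = m + 1 := by rw [Finset.card_erase_of_mem hα, hA]; rfl
    have h1 : ∏ _γ ∈ A.erase α, W ^ (m * (m + 3)) ≤
        ∏ γ ∈ A.erase α, (E * ‖G 0 - γ‖) ^ (m * (m + 3)) :=
      Finset.prod_le_prod (fun _ _ => by positivity) fun γ hγ => by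
        have := hfar γ hγ
        gcongr
    simp only [mul_pow, Finset.prod_mul_distrib, Finset.prod_const, hcard, ← pow_mul] at h1
    rw [mul_comm (m + 1)]
    exact h1
  calc (‖deriv G 0‖ * R) ^ (m * (m + 4)) * W ^ (m * (1 + m * (m + 4)))
      ≤ (3840 * d * (1 + |Real.log (d / ‖β - α‖)|)) ^ (m * (m + 4)) *
        W ^ (m * (1 + m * (m + 4))) := by gcongr
    _ = 3840 ^ (m * (m + 4)) * d ^ (m * (m + 4)) *
        (1 + |Real.log (d / ‖β - α‖)|) ^ (m * (m + 4)) * W ^ (m * (1 + m * (m + 4))) := by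
      rw [mul_pow, mul_pow]
    _ ≤ 3840 ^ (m * (m + 4)) * d ^ (m * (m + 4)) *
        ((m + 5 : ℝ) ^ (m * (m + 4)) * (M₀ * W ^ 2 / d) ^ m) *
        W ^ (m * (1 + m * (m + 4))) := by gcongr
    _ = 3840 ^ (m * (m + 4)) * (m + 5 : ℝ) ^ (m * (m + 4)) * M₀ ^ m * d ^ (m * (m + 3)) *
        W ^ ((m + 1) * (m * (m + 3))) := by
      have h1 : d ^ (m * (m + 4)) = d ^ (m * (m + 3)) * d ^ m := by
        rw [← pow_add]; congr 1
      have h2 : W ^ ((m + 1) * (m * (m + 3))) = (W ^ 2) ^ m * W ^ (m * (1 + m * (m + 4))) := by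
        rw [← pow_mul, ← pow_add]; congr 1; ring
      rw [h1, h2, div_pow, mul_pow]
      field_simp
    _ ≤ 3840 ^ (m * (m + 4)) * (m + 5 : ℝ) ^ (m * (m + 4)) * M₀ ^ m * d ^ (m * (m + 3)) *
        (E ^ ((m + 1) * (m * (m + 3))) * ∏ γ ∈ A.erase α, ‖G 0 - γ‖ ^ (m * (m + 3))) := by
      gcongr
    _ = _ := by
      rw [← Finset.mul_prod_erase A _ hα]
      ring

/-- `Φ` takes values in `U` and solves the complex ordinary differential equation `Φ' = X ∘ Φ`
at the points of `S`. -/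
def SolvesODEOn (X : ℂ → ℂ) (U : Set ℂ) (Φ : ℂ → ℂ) (S : Set ℂ) : Prop :=
  ∀ w ∈ S, Φ w ∈ U ∧ HasDerivAt Φ (X (Φ w)) w

namespace SolvesODEOn

variable {X Φ Ψ : ℂ → ℂ} {U S V : Set ℂ}

theorem mono (h : SolvesODEOn X U Φ S) (hV : V ⊆ S) : SolvesODEOn X U Φ V :=
  fun w hw => h w (hV hw)

theorem differentiableOn (h : SolvesODEOn X U Φ S) : DifferentiableOn ℂ Φ S :=
  fun w hw => (h w hw).2.differentiableAt.differentiableWithinAt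

theorem eventuallyEq (hU : IsOpen U) (hX : DifferentiableOn ℂ X U) (hS : IsOpen S)
    (hΦ : SolvesODEOn X U Φ S) (hΨ : SolvesODEOn X U Ψ S) {c : ℂ} (hc : c ∈ S)
    (heq : Φ c = Ψ c) : Φ =ᶠ[𝓝 c] Ψ := by
  obtain ⟨K, t, ht, hK⟩ := (((hX.analyticAt (hU.mem_nhds (hΦ c hc).1)).contDiffAt
    (n := 1)).exists_lipschitzOnWith)
  have h1 : ∀ᶠ w in 𝓝 c, Φ w ∈ t := (hΦ c hc).2.continuousAt.eventually_mem ht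
  have h2 : ∀ᶠ w in 𝓝 c, Ψ w ∈ t :=
    (hΨ c hc).2.continuousAt.eventually_mem (by rw [← heq]; exact ht)
  obtain ⟨δ₀, hδ₀, hsub⟩ := Metric.eventually_nhds_iff_ball.1
    (h1.and (h2.and (hS.mem_nhds hc)))
  set δ : ℝ := min (δ₀ / 2) (1 / (2 * (K + 1))) with hδ
  have hKpos : (0 : ℝ) < 2 * (K + 1) := by positivity
  have hδpos : 0 < δ := lt_min (by linarith) (by positivity)
  have hδK : K * δ ≤ 1 / 2 := by
    have : δ ≤ 1 / (2 * (K + 1)) := min_le_right _ _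
    rw [le_div_iff₀ hKpos] at this
    nlinarith [K.coe_nonneg]
  have hball : Metric.closedBall c δ ⊆ Metric.ball c δ₀ :=
    Metric.closedBall_subset_ball ((min_le_left _ _).trans_lt (by linarith))
  have hd : ∀ w ∈ Metric.closedBall c δ,
      HasDerivAt (fun w => Φ w - Ψ w) (X (Φ w) - X (Ψ w)) w := fun w hw =>
    (hΦ w (hsub w (hball hw)).2.2).2.sub (hΨ w (hsub w (hball hw)).2.2).2
  obtain ⟨a, ha, hmax⟩ := (isCompact_closedBall c δ).exists_isMaxOn
    ⟨c, Metric.mem_closedBall_self hδpos.le⟩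
    (fun w hw => (hd w hw).continuousAt.continuousWithinAt.norm)
  have hmax' : ∀ w ∈ Metric.closedBall c δ, ‖Φ w - Ψ w‖ ≤ ‖Φ a - Ψ a‖ := fun w hw => hmax hw
  have hmv := (convex_closedBall c δ).norm_image_sub_le_of_norm_hasDerivWithin_le
    (C := K * ‖Φ a - Ψ a‖) (fun w hw => (hd w hw).hasDerivWithinAt) (fun w hw => by
      have h3 := hsub w (hball hw)
      refine (hK.norm_sub_le h3.1 h3.2.1).trans ?_
      gcongr
      exact hmax' w hw) (Metric.mem_closedBall_self hδpos.le) ha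
  rw [heq, sub_self, sub_zero] at hmv
  rw [mem_closedBall_iff_norm] at ha
  have hzero : ‖Φ a - Ψ a‖ ≤ 0 := by
    have h4 : K * ‖Φ a - Ψ a‖ * ‖a - c‖ ≤ K * ‖Φ a - Ψ a‖ * δ := by gcongr
    nlinarith [norm_nonneg (Φ a - Ψ a)]
  filter_upwards [Metric.closedBall_mem_nhds c hδpos] with w hw
  exact sub_eq_zero.1 (norm_le_zero_iff.1 ((hmax' w hw).trans hzero))

theorem eqOn (hU : IsOpen U) (hX : DifferentiableOn ℂ X U) (hS : IsOpen S)
    (hSc : IsPreconnected S) (hΦ : SolvesODEOn X U Φ S) (hΨ : SolvesODEOn X U Ψ S) {c : ℂ}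
    (hc : c ∈ S) (heq : Φ c = Ψ c) : EqOn Φ Ψ S :=
  (hΦ.differentiableOn.analyticOnNhd hS).eqOn_of_preconnected_of_eventuallyEq
    (hΨ.differentiableOn.analyticOnNhd hS) hSc hc (eventuallyEq hU hX hS hΦ hΨ hc heq)

theorem congr_of_isOpen (hS : IsOpen S) (hΨ : SolvesODEOn X U Ψ S) (h : EqOn Φ Ψ S) :
    SolvesODEOn X U Φ S := by
  intro w hw
  rw [h hw]
  exact ⟨(hΨ w hw).1, (hΨ w hw).2.congr_of_eventuallyEq (h.eventuallyEq_of_mem (hS.mem_nhds hw))⟩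

theorem exists_glue {P : Set ℂ → (ℂ → ℂ) → Prop}
    (hP : ∀ V Ψ, P V Ψ → IsOpen V ∧ SolvesODEOn X U Ψ V)
    (hc : ∀ V Ψ V' Ψ', P V Ψ → P V' Ψ' → EqOn Ψ Ψ' (V ∩ V')) :
    ∃ Φ : ℂ → ℂ, ∀ V Ψ, P V Ψ → EqOn Φ Ψ V ∧ SolvesODEOn X U Φ V := by
  classical
  have hex : ∀ w : ℂ, ∃ y : ℂ, ∀ V Ψ, P V Ψ → w ∈ V → y = Ψ w := by
    intro w
    by_cases h : ∃ V Ψ, P V Ψ ∧ w ∈ V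
    · obtain ⟨V, Ψ, hV, hw⟩ := h
      exact ⟨Ψ w, fun V' Ψ' hV' hw' => hc V Ψ V' Ψ' hV hV' ⟨hw, hw'⟩⟩
    · push Not at h
      exact ⟨0, fun V Ψ hV hw => absurd hw (h V Ψ hV)⟩
  choose Φ hΦ using hex
  refine ⟨Φ, fun V Ψ hV => ?_⟩
  have : EqOn Φ Ψ V := fun w hw => hΦ w V Ψ hV hw
  exact ⟨this, congr_of_isOpen (hP V Ψ hV).1 (hP V Ψ hV).2 this⟩

/-- If a solution on a disc can be continued near every boundary point, then it can be continued
to a larger disc. -/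
theorem exists_larger_disc (hU : IsOpen U) (hX : DifferentiableOn ℂ X U) {R : ℝ} (hR : 0 < R)
    (hΦ : SolvesODEOn X U Φ (Metric.ball 0 R))
    (hext : ∀ w ∈ Metric.sphere (0 : ℂ) R, ∃ c ∈ Metric.ball (0 : ℂ) R, ∃ ε : ℝ, ∃ Ψ : ℂ → ℂ,
      w ∈ Metric.ball c ε ∧ Ψ c = Φ c ∧ SolvesODEOn X U Ψ (Metric.ball c ε)) :
    ∃ R' > R, ∃ Φ' : ℂ → ℂ, Φ' 0 = Φ 0 ∧ SolvesODEOn X U Φ' (Metric.ball 0 R') := by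
  set P : Set ℂ → (ℂ → ℂ) → Prop := fun V Ψ => ∃ c ∈ Metric.ball (0 : ℂ) R, ∃ ε > (0 : ℝ),
    V = Metric.ball c ε ∧ Ψ c = Φ c ∧ SolvesODEOn X U Ψ V with hPdef
  have hagree : ∀ c ∈ Metric.ball (0 : ℂ) R, ∀ ε > (0 : ℝ), ∀ Ψ : ℂ → ℂ, Ψ c = Φ c →
      SolvesODEOn X U Ψ (Metric.ball c ε) → EqOn Ψ Φ (Metric.ball c ε ∩ Metric.ball 0 R) := by
    intro c hc ε hε Ψ hΨc hΨ
    exact eqOn hU hX (Metric.isOpen_ball.inter Metric.isOpen_ball)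
      ((convex_ball c ε).inter (convex_ball 0 R)).isPreconnected (hΨ.mono inter_subset_left)
      (hΦ.mono inter_subset_right) ⟨Metric.mem_ball_self hε, hc⟩ hΨc
  obtain ⟨Φ', hΦ'⟩ := exists_glue (X := X) (U := U) (P := P)
    (by
      rintro V Ψ ⟨c, -, ε, -, rfl, -, hΨ⟩
      exact ⟨Metric.isOpen_ball, hΨ⟩)
    (by
      rintro V Ψ V' Ψ' ⟨c, hc, ε, hε, rfl, hΨc, hΨ⟩ ⟨c', hc', ε', hε', rfl, hΨc', hΨ'⟩
      rintro w ⟨hw, hw'⟩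
      have hdist : dist c c' < ε + ε' :=
        (dist_triangle_left c c' w).trans_lt (add_lt_add hw hw')
      have hpos : 0 < ε + ε' := by linarith
      set θ : ℝ := ε / (ε + ε') with hθ
      have hθ0 : 0 ≤ θ := by positivity
      have hθ1 : 1 - θ = ε' / (ε + ε') := by rw [hθ]; field_simp; ring
      set y : ℂ := AffineMap.lineMap c c' θ with hy
      have hyR : y ∈ Metric.ball (0 : ℂ) R := by
        refine (convex_ball (0 : ℂ) R).lineMap_mem hc hc' ⟨hθ0, ?_⟩
        have : 0 ≤ 1 - θ := by rw [hθ1]; positivity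
        linarith
      have hyc : y ∈ Metric.ball c ε := by
        rw [Metric.mem_ball, hy, dist_lineMap_left, Real.norm_of_nonneg hθ0, hθ,
          div_mul_eq_mul_div, div_lt_iff₀ hpos]
        gcongr
      have hyc' : y ∈ Metric.ball c' ε' := by
        rw [Metric.mem_ball, hy, dist_lineMap_right, hθ1, Real.norm_of_nonneg (by positivity),
          div_mul_eq_mul_div, div_lt_iff₀ hpos]
        gcongr
      have hyeq : Ψ y = Ψ' y :=
        (hagree c hc ε hε Ψ hΨc hΨ ⟨hyc, hyR⟩).trans
          (hagree c' hc' ε' hε' Ψ' hΨc' hΨ' ⟨hyc', hyR⟩).symm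
      exact eqOn hU hX (Metric.isOpen_ball.inter Metric.isOpen_ball)
        ((convex_ball c ε).inter (convex_ball c' ε')).isPreconnected
        (hΨ.mono inter_subset_left) (hΨ'.mono inter_subset_right) ⟨hyc, hyc'⟩ hyeq ⟨hw, hw'⟩)
  set E : Set ℂ := ⋃ p : {p : Set ℂ × (ℂ → ℂ) // P p.1 p.2}, p.1.1 with hE
  have hEopen : IsOpen E := isOpen_iUnion fun p => by
    obtain ⟨c, -, ε, -, h, -, -⟩ := p.2
    rw [h]
    exact Metric.isOpen_ball
  have h0mem : (0 : ℂ) ∈ Metric.ball (0 : ℂ) R := Metric.mem_ball_self hR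
  have hP0 : P (Metric.ball 0 R) Φ := ⟨0, h0mem, R, hR, rfl, rfl, hΦ⟩
  have hsub : Metric.closedBall (0 : ℂ) R ⊆ E := by
    intro w hw
    rw [hE, mem_iUnion]
    rw [← Metric.ball_union_sphere] at hw
    rcases hw with hw | hw
    · exact ⟨⟨(_, _), hP0⟩, hw⟩
    · obtain ⟨c, hc, ε, Ψ, hwc, hΨc, hΨ⟩ := hext w hw
      exact ⟨⟨(Metric.ball c ε, Ψ), c, hc, ε, Metric.pos_of_mem_ball hwc, rfl, hΨc, hΨ⟩, hwc⟩
  obtain ⟨δ, hδ, hthick⟩ := (isCompact_closedBall (0 : ℂ) R).exists_thickening_subset_open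
    hEopen hsub
  rw [thickening_closedBall hδ hR.le] at hthick
  refine ⟨δ + R, by linarith, Φ', (hΦ' _ _ hP0).1 h0mem, fun w hw => ?_⟩
  obtain ⟨p, hp⟩ := mem_iUnion.1 (hthick hw)
  exact (hΦ' _ _ p.2).2 w hp

end SolvesODEOn

/-- A holomorphic vector field which is Lipschitz and small compared with the size of a disc can
be integrated starting from any point of the concentric disc of half the radius. -/
theorem exists_solvesODEOn_of_lipschitz {X : ℂ → ℂ} {z₁ : ℂ} {ρ ε M : ℝ} {K : NNReal}
    (hρ : 0 < ρ) (hε : 0 < ε) (hX : DifferentiableOn ℂ X (Metric.ball z₁ ρ))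
    (hK : LipschitzOnWith K X (Metric.ball z₁ ρ)) (hM : ∀ z ∈ Metric.ball z₁ ρ, ‖X z‖ ≤ M)
    (hMε : M * ε ≤ ρ / 4) (hKε : K * ε ≤ 1 / 2) {z : ℂ} (hz : z ∈ Metric.ball z₁ (ρ / 2))
    (c : ℂ) : ∃ Φ : ℂ → ℂ, Φ c = z ∧ SolvesODEOn X (Metric.ball z₁ ρ) Φ (Metric.ball c ε) := by
  have hsub : Metric.closedBall z (ρ / 4) ⊆ Metric.ball z₁ ρ := by
    intro w hw
    rw [Metric.mem_closedBall] at hw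
    rw [Metric.mem_ball] at hz ⊢
    linarith [dist_triangle w z z₁]
  have hcm : c ∈ Metric.ball c ε := Metric.mem_ball_self hε
  have hM0 : 0 ≤ M := (norm_nonneg _).trans
    (hM z (hsub (Metric.mem_closedBall_self (by positivity))))
  let Q : (ℂ → ℂ) → Prop := fun Φ => DifferentiableOn ℂ Φ (Metric.ball c ε) ∧
    MapsTo Φ (Metric.ball c ε) (Metric.closedBall z (ρ / 4)) ∧ Φ c = z
  have hstep : ∀ Φ : {Φ // Q Φ}, ∃ Ψ : {Ψ // Q Ψ},
      ∀ w ∈ Metric.ball c ε, HasDerivAt Ψ.1 (X (Φ.1 w)) w := by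
    rintro ⟨Φ, hΦd, hΦm, hΦc⟩
    have hcomp : DifferentiableOn ℂ (fun w => X (Φ w)) (Metric.ball c ε) :=
      hX.comp hΦd fun w hw => hsub (hΦm hw)
    obtain ⟨Ψ, hΨc, hΨ⟩ := hcomp.isExactOn_ball.with_val_at c z
    refine ⟨⟨Ψ, fun w hw => (hΨ w hw).differentiableAt.differentiableWithinAt, fun w hw => ?_,
      hΨc⟩, hΨ⟩
    have h := (convex_ball c ε).norm_image_sub_le_of_norm_hasDerivWithin_le (C := M)
      (fun w hw => (hΨ w hw).hasDerivWithinAt) (fun w hw => hM _ (hsub (hΦm hw))) hcm hw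
    rw [hΨc] at h
    rw [mem_closedBall_iff_norm]
    rw [mem_ball_iff_norm] at hw
    nlinarith
  choose step hstep using hstep
  let Φ : ℕ → {Φ // Q Φ} := fun n => step^[n]
    ⟨fun _ => z, differentiableOn_const _, fun _ _ => Metric.mem_closedBall_self (by positivity),
      rfl⟩
  have hderiv : ∀ n, ∀ w ∈ Metric.ball c ε, HasDerivAt (Φ (n + 1)).1 (X ((Φ n).1 w)) w := by
    intro n w hw
    simp only [Φ, Function.iterate_succ', Function.comp_apply]
    exact hstep _ w hw
  have hdist : ∀ n, ∀ w ∈ Metric.ball c ε,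
      dist ((Φ n).1 w) ((Φ (n + 1)).1 w) ≤ ρ / 2 * (1 / 2) ^ n := by
    intro n
    induction n with
    | zero =>
      intro w hw
      have h0 := (Φ 0).2.2.1 hw
      have h1 := (Φ 1).2.2.1 hw
      rw [Metric.mem_closedBall] at h0 h1
      rw [pow_zero]
      linarith [dist_triangle_right ((Φ 0).1 w) ((Φ 1).1 w) z]
    | succ n ih =>
      intro w hw
      have h := (convex_ball c ε).norm_image_sub_le_of_norm_hasDerivWithin_le
        (C := K * (ρ / 2 * (1 / 2) ^ n))
        (fun w hw => ((hderiv n w hw).sub (hderiv (n + 1) w hw)).hasDerivWithinAt)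
        (fun w hw => by
          refine (hK.norm_sub_le (hsub ((Φ n).2.2.1 hw)) (hsub ((Φ (n + 1)).2.2.1 hw))).trans ?_
          rw [← dist_eq_norm]
          gcongr
          exact ih w hw) hcm hw
      simp only [Pi.sub_apply, (Φ (n + 1)).2.2.2, (Φ (n + 1 + 1)).2.2.2, sub_self, sub_zero] at h
      rw [dist_eq_norm]
      refine h.trans ?_
      rw [mem_ball_iff_norm] at hw
      calc (K : ℝ) * (ρ / 2 * (1 / 2) ^ n) * ‖w - c‖ ≤ K * (ρ / 2 * (1 / 2) ^ n) * ε := by gcongr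
        _ = ρ / 2 * (1 / 2) ^ n * (K * ε) := by ring
        _ ≤ ρ / 2 * (1 / 2) ^ n * (1 / 2) := by gcongr
        _ = _ := by ring
  have hlim : ∀ w, ∃ y, w ∈ Metric.ball c ε → Tendsto (fun n => (Φ n).1 w) atTop (𝓝 y) := by
    intro w
    by_cases hw : w ∈ Metric.ball c ε
    · obtain ⟨y, hy⟩ := cauchySeq_tendsto_of_complete
        (cauchySeq_of_le_geometric (1 / 2) (ρ / 2) (by norm_num) (fun n => hdist n w hw))
      exact ⟨y, fun _ => hy⟩
    · exact ⟨0, fun h => absurd h hw⟩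
  choose Ψ hΨ using hlim
  have hunif : TendstoUniformlyOn (fun n => (Φ n).1) Ψ atTop (Metric.ball c ε) := by
    rw [Metric.tendstoUniformlyOn_iff]
    intro δ hδ
    have hgeo : Tendsto (fun n : ℕ => ρ / 2 * (1 / 2 : ℝ) ^ n / (1 - 1 / 2)) atTop (𝓝 0) := by
      have := ((tendsto_pow_atTop_nhds_zero_of_lt_one (r := (1 / 2 : ℝ)) (by norm_num)
        (by norm_num)).const_mul (ρ / 2)).div_const (1 - 1 / 2)
      simpa using this
    filter_upwards [hgeo.eventually_lt_const hδ] with n hn w hw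
    rw [dist_comm]
    exact (dist_le_of_le_geometric_of_tendsto (1 / 2) (ρ / 2) (by norm_num)
      (fun n => hdist n w hw) (hΨ w hw) n).trans_lt hn
  have hloc := hunif.tendstoLocallyUniformlyOn
  have hd := hloc.differentiableOn (Eventually.of_forall fun n => (Φ n).2.1) Metric.isOpen_ball
  have hdl := hloc.deriv (Eventually.of_forall fun n => (Φ n).2.1) Metric.isOpen_ball
  refine ⟨Ψ, ?_, fun w hw => ?_⟩
  · refine tendsto_nhds_unique (hΨ c hcm) ?_
    simp only [(Φ _).2.2.2]
    exact tendsto_const_nhds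
  · have hmem : Ψ w ∈ Metric.ball z₁ ρ := hsub
      (Metric.isClosed_closedBall.mem_of_tendsto (hΨ w hw)
        (Eventually.of_forall fun n => (Φ n).2.2.1 hw))
    refine ⟨hmem, ?_⟩
    have h1 : Tendsto (fun n => deriv (Φ (n + 1)).1 w) atTop (𝓝 (deriv Ψ w)) :=
      (hdl.tendsto_at hw).comp (tendsto_add_atTop_nat 1)
    have h2 : Tendsto (fun n => X ((Φ n).1 w)) atTop (𝓝 (X (Ψ w))) :=
      (hX.differentiableAt (Metric.isOpen_ball.mem_nhds hmem)).continuousAt.tendsto.comp (hΨ w hw)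
    have h3 : deriv Ψ w = X (Ψ w) := by
      refine tendsto_nhds_unique h1 (h2.congr fun n => ?_)
      exact (hderiv n w hw).deriv.symm
    rw [← h3]
    exact (hd.differentiableAt (Metric.isOpen_ball.mem_nhds hw)).hasDerivAt

namespace SolvesODEOn

theorem exists_local {X : ℂ → ℂ} {U : Set ℂ} (hU : IsOpen U) (hX : DifferentiableOn ℂ X U)
    {z₁ : ℂ} (hz₁ : z₁ ∈ U) :
    ∃ r > 0, ∃ ε > 0, ∀ z ∈ Metric.ball z₁ r, ∀ c : ℂ, ∃ Φ : ℂ → ℂ, Φ c = z ∧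
      SolvesODEOn X U Φ (Metric.ball c ε) := by
  obtain ⟨K, t, ht, hK⟩ := (((hX.analyticAt (hU.mem_nhds hz₁)).contDiffAt
    (n := 1)).exists_lipschitzOnWith)
  obtain ⟨ρ₀, hρ₀, hsub₀⟩ := Metric.mem_nhds_iff.1 (inter_mem ht (hU.mem_nhds hz₁))
  set ρ := min ρ₀ 1 with hρdef
  have hρ : 0 < ρ := lt_min hρ₀ one_pos
  have hsub : Metric.ball z₁ ρ ⊆ t ∩ U :=
    (Metric.ball_subset_ball (min_le_left _ _)).trans hsub₀
  set M : ℝ := ‖X z₁‖ + K with hMdef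
  have hM0 : 0 ≤ M := by positivity
  have hM : ∀ z ∈ Metric.ball z₁ ρ, ‖X z‖ ≤ M := by
    intro z hz
    have h1 := hK.norm_sub_le (hsub hz).1 (hsub (Metric.mem_ball_self hρ)).1
    have h2 : ‖z - z₁‖ ≤ 1 := (mem_ball_iff_norm.1 hz).le.trans (min_le_right _ _)
    have h3 : K * ‖z - z₁‖ ≤ K * 1 := by gcongr
    have h4 : ‖X z‖ ≤ ‖X z - X z₁‖ + ‖X z₁‖ := by simpa using norm_add_le (X z - X z₁) (X z₁)
    rw [hMdef]
    linarith
  set ε : ℝ := min (ρ / 4 / (M + 1)) (1 / 2 / (K + 1)) with hεdef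
  have hε : 0 < ε := lt_min (by positivity) (by positivity)
  refine ⟨ρ / 2, by positivity, ε, hε, fun z hz c => ?_⟩
  obtain ⟨Φ, hΦc, hΦ⟩ := exists_solvesODEOn_of_lipschitz hρ hε
    (hX.mono fun w hw => (hsub hw).2) (hK.mono fun w hw => (hsub hw).1) hM
    (by
      have h : ε ≤ ρ / 4 / (M + 1) := min_le_left _ _
      rw [le_div_iff₀ (by positivity)] at h
      nlinarith)
    (by
      have h : ε ≤ 1 / 2 / (K + 1) := min_le_right _ _
      rw [le_div_iff₀ (by positivity)] at h
      nlinarith) hz c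
  exact ⟨Φ, hΦc, fun w hw => ⟨(hsub (hΦ w hw).1).2, (hΦ w hw).2⟩⟩

/-- A holomorphic vector field has either solutions of arbitrarily large radius through a given
point, or a solution on a disc which leaves all compact sets along some radius. -/
theorem exists_all_or_divergent_radius {X : ℂ → ℂ} {U : Set ℂ} (hU : IsOpen U)
    (hX : DifferentiableOn ℂ X U) {z₀ : ℂ} (hz₀ : z₀ ∈ U) :
    (∀ R : ℝ, 0 < R → ∃ Φ : ℂ → ℂ, Φ 0 = z₀ ∧ SolvesODEOn X U Φ (Metric.ball 0 R)) ∨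
    ∃ R : ℝ, 0 < R ∧ ∃ Φ : ℂ → ℂ, Φ 0 = z₀ ∧ SolvesODEOn X U Φ (Metric.ball 0 R) ∧
      ∃ w : ℂ, ‖w‖ = R ∧ ∀ K : Set ℂ, IsCompact K → K ⊆ U →
        ∃ t₀ ∈ Ico (0 : ℝ) 1, ∀ t : ℝ, t₀ ≤ t → t < 1 → Φ (t • w) ∉ K := by
  refine or_iff_not_imp_left.2 fun hall => ?_
  push Not at hall
  obtain ⟨R₁, hR₁, hno⟩ := hall
  set S : Set ℝ := {R | 0 < R ∧ ∃ Φ : ℂ → ℂ, Φ 0 = z₀ ∧ SolvesODEOn X U Φ (Metric.ball 0 R)}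
    with hS
  have hbdd : BddAbove S := by
    refine ⟨R₁, fun R ⟨_, Φ, h0, hΦ⟩ => ?_⟩
    by_contra! h
    exact hno Φ h0 (hΦ.mono (Metric.ball_subset_ball h.le))
  obtain ⟨r, hr, ε, hε, hloc⟩ := exists_local hU hX hz₀
  have hεS : ε ∈ S := ⟨hε, hloc z₀ (Metric.mem_ball_self hr) 0⟩
  have hRpos : 0 < sSup S := hε.trans_le (le_csSup hbdd hεS)
  obtain ⟨Φ, hΦ⟩ := exists_glue (X := X) (U := U)
    (P := fun V Ψ => ∃ R, 0 < R ∧ V = Metric.ball 0 R ∧ Ψ 0 = z₀ ∧ SolvesODEOn X U Ψ V)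
    (by
      rintro V Ψ ⟨R, -, rfl, -, h⟩
      exact ⟨Metric.isOpen_ball, h⟩)
    (by
      rintro V Ψ V' Ψ' ⟨R, hR, rfl, h0, h⟩ ⟨R', hR', rfl, h0', h'⟩
      exact eqOn hU hX (Metric.isOpen_ball.inter Metric.isOpen_ball)
        ((convex_ball 0 R).inter (convex_ball 0 R')).isPreconnected (h.mono inter_subset_left)
        (h'.mono inter_subset_right) ⟨Metric.mem_ball_self hR, Metric.mem_ball_self hR'⟩
        (h0.trans h0'.symm))
  have hΦ0 : Φ 0 = z₀ := by
    obtain ⟨hε, Ψ, h0, h⟩ := hεS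
    rw [← h0]
    exact (hΦ _ _ ⟨ε, hε, rfl, h0, h⟩).1 (Metric.mem_ball_self hε)
  have hsol : SolvesODEOn X U Φ (Metric.ball 0 (sSup S)) := by
    intro w hw
    obtain ⟨R, ⟨hR, Ψ, h0, h⟩, hwR⟩ := exists_lt_of_lt_csSup ⟨ε, hεS⟩ (mem_ball_zero_iff.1 hw)
    exact (hΦ _ _ ⟨R, hR, rfl, h0, h⟩).2 w (mem_ball_zero_iff.2 hwR)
  refine ⟨sSup S, hRpos, Φ, hΦ0, hsol, ?_⟩
  by_contra! hcon
  obtain ⟨R', hR', Φ', hΦ'0, hΦ'⟩ := exists_larger_disc hU hX hRpos hsol (by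
    intro w hw
    rw [mem_sphere_zero_iff_norm] at hw
    obtain ⟨K, hKc, hKU, hK⟩ := hcon w hw
    have hseq : ∀ n : ℕ, ∃ t : ℝ, 1 - 1 / ((n : ℝ) + 1) ≤ t ∧ t < 1 ∧ Φ (t • w) ∈ K := by
      intro n
      refine hK _ ⟨?_, ?_⟩
      · rw [sub_nonneg, div_le_one (by positivity)]
        linarith [n.cast_nonneg (α := ℝ)]
      · have : 0 < 1 / ((n : ℝ) + 1) := by positivity
        linarith
    choose t ht1 ht2 htK using hseq
    obtain ⟨z₁, hz₁, φ, hφ, hlim⟩ := hKc.tendsto_subseq htK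
    obtain ⟨r, hr, ε, hε, hloc⟩ := exists_local hU hX (hKU hz₁)
    have ht : Tendsto t atTop (𝓝 1) := by
      refine tendsto_of_tendsto_of_tendsto_of_le_of_le (g := fun n : ℕ => 1 - 1 / ((n : ℝ) + 1))
        (h := fun _ => 1) ?_ tendsto_const_nhds ht1 fun n => (ht2 n).le
      simpa using tendsto_one_div_add_atTop_nhds_zero_nat.const_sub (1 : ℝ)
    have htw : Tendsto (fun n => t (φ n) • w) atTop (𝓝 w) := by
      simpa using (ht.comp hφ.tendsto_atTop).smul_const w
    have h1 : ∀ᶠ n in atTop, Φ (t (φ n) • w) ∈ Metric.ball z₁ r :=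
      hlim.eventually_mem (Metric.ball_mem_nhds _ hr)
    have h2 : ∀ᶠ n in atTop, t (φ n) • w ∈ Metric.ball w ε :=
      htw.eventually_mem (Metric.ball_mem_nhds _ hε)
    obtain ⟨n, hn1, hn2⟩ := (h1.and h2).exists
    obtain ⟨Ψ, hΨc, hΨ⟩ := hloc _ hn1 (t (φ n) • w)
    refine ⟨t (φ n) • w, ?_, ε, Ψ, Metric.mem_ball_comm.1 hn2, hΨc, hΨ⟩
    have h0 : 0 ≤ t (φ n) := by
      refine le_trans ?_ (ht1 _)
      rw [sub_nonneg, div_le_one (by positivity)]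
      linarith [(φ n).cast_nonneg (α := ℝ)]
    rw [mem_ball_zero_iff, norm_smul, Real.norm_of_nonneg h0, hw]
    nlinarith [ht2 (φ n)])
  exact absurd (le_csSup hbdd ⟨hRpos.trans hR', Φ', hΦ'0.trans hΦ0, hΦ'⟩) (not_le.2 hR')

end SolvesODEOn

/-- The vector field whose flow lines are used to construct divergent paths of finite length. -/
def fujimotoField (m : ℕ) (A : Finset ℂ) (h F : ℂ → ℂ) (z : ℂ) : ℂ :=
  deriv h z ^ (m * (m + 4)) /
    (F z ^ (1 + m * (m + 4)) * ∏ α ∈ A, (h z - α) ^ (m * (m + 3)))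

theorem differentiableOn_fujimotoField {m : ℕ} {A : Finset ℂ} {h F : ℂ → ℂ} {U : Set ℂ}
    (hU : IsOpen U) (hh : DifferentiableOn ℂ h U) (hF : DifferentiableOn ℂ F U)
    (hF0 : ∀ z ∈ U, F z ≠ 0) (homit : ∀ z ∈ U, h z ∉ A) :
    DifferentiableOn ℂ (fujimotoField m A h F) U := by
  refine DifferentiableOn.div ((hh.deriv hU).pow _) ((hF.pow _).mul
    (DifferentiableOn.fun_finsetProd fun α _ => (hh.sub_const α).pow _)) fun z hz => ?_
  refine mul_ne_zero (pow_ne_zero _ (hF0 z hz)) (Finset.prod_ne_zero_iff.2 fun α hα => ?_)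
  exact pow_ne_zero _ (sub_ne_zero.2 fun h => homit z hz (h ▸ hα))

theorem exists_fujimotoField_bound (m : ℕ) (A : Finset ℂ) (hA : A.card = m + 2) :
    ∃ B : ℝ, 0 < B ∧ ∀ (U : Set ℂ) (h F Φ : ℂ → ℂ) (R : ℝ), IsOpen U → DifferentiableOn ℂ h U →
      (∀ z ∈ U, F z ≠ 0) → (∀ z ∈ U, h z ∉ A) →
      SolvesODEOn (fujimotoField m A h F) U Φ (Metric.ball 0 R) → ∀ w ∈ Metric.ball (0 : ℂ) R,
      (‖fujimotoField m A h F (Φ w)‖ * ‖F (Φ w)‖ * (1 + ‖h (Φ w)‖) ^ m) ^ (1 + m * (m + 4)) *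
        (R - ‖w‖) ^ (m * (m + 4)) ≤ B := by
  obtain ⟨B, hB, hL⟩ := exists_weighted_landau m A hA
  refine ⟨B, hB, fun U h F Φ R hU hh hF0 homit hΦ w hw => ?_⟩
  have hw' : ‖w‖ < R := mem_ball_zero_iff.1 hw
  have hshift : ∀ ζ ∈ Metric.ball (0 : ℂ) (R - ‖w‖), w + ζ ∈ Metric.ball (0 : ℂ) R := by
    intro ζ hζ
    rw [mem_ball_zero_iff] at hζ ⊢
    linarith [norm_add_le w ζ]
  have hG : ∀ ζ ∈ Metric.ball (0 : ℂ) (R - ‖w‖), HasDerivAt (fun ζ => h (Φ (w + ζ)))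
      (deriv h (Φ (w + ζ)) * fujimotoField m A h F (Φ (w + ζ))) ζ := by
    intro ζ hζ
    obtain ⟨h1, h2⟩ := hΦ _ (hshift ζ hζ)
    have h3 : HasDerivAt (fun ζ => Φ (w + ζ)) (fujimotoField m A h F (Φ (w + ζ))) ζ :=
      h2.comp_const_add w ζ
    exact ((hh.differentiableAt (hU.mem_nhds h1)).hasDerivAt).comp ζ h3
  have key := hL (R - ‖w‖) (fun ζ => h (Φ (w + ζ))) (by linarith)
    (fun ζ hζ => (hG ζ hζ).differentiableAt.differentiableWithinAt)
    (fun ζ hζ => homit _ (hΦ _ (hshift ζ hζ)).1)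
  rw [(hG 0 (Metric.mem_ball_self (by linarith))).deriv] at key
  simp only [add_zero, norm_mul] at key
  have hp := (hΦ w hw).1
  set p := Φ w
  set P : ℝ := ∏ α ∈ A, ‖h p - α‖ ^ (m * (m + 3)) with hP
  have hPpos : 0 < P := Finset.prod_pos fun α hα => pow_pos
    (norm_pos_iff.2 (sub_ne_zero.2 fun e : h p = α => homit p hp (e ▸ hα))) _
  have hfpos : 0 < ‖F p‖ := norm_pos_iff.2 (hF0 p hp)
  have hX : ‖deriv h p‖ ^ (m * (m + 4)) =
      ‖fujimotoField m A h F p‖ * (‖F p‖ ^ (1 + m * (m + 4)) * P) := by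
    rw [fujimotoField, norm_div, norm_mul, norm_pow, norm_pow, norm_prod]
    simp only [norm_pow]
    rw [← hP, div_mul_cancel₀]
    positivity
  refine le_of_mul_le_mul_right ?_ hPpos
  refine le_trans (le_of_eq ?_) key
  rw [mul_pow (_ * _) (R - ‖w‖), mul_pow ‖deriv h p‖, hX]
  ring

/-- A metric dominated by `(1 + |h|) ^ m |F| |dz|`, with `h` nonconstant and omitting `m + 2` finite
values and `F` nowhere zero, has a divergent path of finite length. -/
theorem exists_divergentPath_pathLen_ne_top {m : ℕ} (hm : 0 < m) {U : Set ℂ} (hU : IsOpen U)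
    (hUc : IsPreconnected U) {h F : ℂ → ℂ} {lam : ℂ → ℝ} {C : ℝ} (hC : 0 ≤ C)
    (hh : DifferentiableOn ℂ h U) (hF : DifferentiableOn ℂ F U) (hF0 : ∀ z ∈ U, F z ≠ 0)
    {A : Finset ℂ} (hA : A.card = m + 2) (homit : ∀ z ∈ U, h z ∉ A)
    (hnc : ∃ z ∈ U, ∃ w ∈ U, h z ≠ h w)
    (hlam : ∀ z ∈ U, lam z ≤ C * ((1 + ‖h z‖) ^ m * ‖F z‖)) :
    ∃ p ∈ U, ∃ γ : DivergentPath U p, pathLen lam γ.toFun ≠ ⊤ := by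
  obtain ⟨z₀, hz₀, hz₀'⟩ : ∃ z₀ ∈ U, deriv h z₀ ≠ 0 := by
    by_contra! hcon
    obtain ⟨z, hz, w, hw, hzw⟩ := hnc
    exact hzw (hU.is_const_of_deriv_eq_zero hUc hh hcon hz hw)
  obtain ⟨B, hB, hbound⟩ := exists_fujimotoField_bound m A hA
  have hX := differentiableOn_fujimotoField (m := m) hU hh hF hF0 homit
  set s : ℕ := m * (m + 4) with hs
  set X := fujimotoField m A h F with hXdef
  have hs0 : s ≠ 0 := by positivity
  rcases SolvesODEOn.exists_all_or_divergent_radius hU hX hz₀ with hall | hdiv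
  · exfalso
    have hX0 : X z₀ ≠ 0 := by
      rw [hXdef, fujimotoField]
      refine div_ne_zero (pow_ne_zero _ hz₀') (mul_ne_zero (pow_ne_zero _ (hF0 z₀ hz₀))
        (Finset.prod_ne_zero_iff.2 fun α hα => ?_))
      exact pow_ne_zero _ (sub_ne_zero.2 fun h => homit z₀ hz₀ (h ▸ hα))
    have hF0' := hF0 z₀ hz₀
    set y : ℝ := (‖X z₀‖ * ‖F z₀‖ * (1 + ‖h z₀‖) ^ m) ^ (1 + s) with hy
    have hypos : 0 < y := by positivity
    set R : ℝ := B / y + 1 with hR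
    have hR1 : 1 ≤ R := by rw [hR]; linarith [div_pos hB hypos]
    obtain ⟨Φ, hΦ0, hΦ⟩ := hall R (by linarith)
    have h1 := hbound U h F Φ R hU hh hF0 homit hΦ 0 (Metric.mem_ball_self (by linarith))
    rw [hΦ0, norm_zero, sub_zero, ← hy] at h1
    have h2 : R ≤ R ^ s := le_self_pow₀ hR1 hs0
    have h3 : y * R ≤ B := (mul_le_mul_of_nonneg_left h2 hypos.le).trans h1
    rw [hR, mul_add, mul_div_cancel₀ _ hypos.ne'] at h3
    linarith
  · obtain ⟨R, hR, Φ, hΦ0, hΦ, w, hw, hdiv⟩ := hdiv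
    have hmem : ∀ t ∈ Ico (0 : ℝ) 1, t • w ∈ Metric.ball (0 : ℂ) R := by
      intro t ht
      rw [mem_ball_zero_iff, norm_smul, Real.norm_of_nonneg ht.1, hw]
      nlinarith [ht.2]
    have hderiv : ∀ t ∈ Ico (0 : ℝ) 1,
        HasDerivAt (fun t : ℝ => Φ (t • w)) (w * X (Φ (t • w))) t := by
      intro t ht
      have h1 : HasDerivAt (fun t : ℝ => t • w) w t := by
        simpa using (hasDerivAt_id t).smul_const w
      exact (hΦ _ (hmem t ht)).2.scomp t h1
    let γ : DivergentPath U z₀ :=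
      { toFun := fun t => Φ (t • w)
        start := by simpa using hΦ0
        mem := fun t ht => (hΦ _ (hmem t ht)).1
        cont := fun t ht => (hderiv t ht).continuousAt.continuousWithinAt
        diff := fun t ht => (hderiv t ⟨ht.1.le, ht.2⟩).differentiableAt
        divergent := hdiv }
    refine ⟨z₀, hz₀, γ, ?_⟩
    set a : ℝ := -(s / (1 + s)) with ha
    have ha1 : -1 < a := by
      rw [ha, neg_lt_neg_iff, div_lt_one (by positivity)]
      linarith
    set D : ℝ := max 1 (B / R ^ s) with hD
    have hD1 : 1 ≤ D := le_max_left _ _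
    have hintegrable : IntegrableOn (fun t : ℝ => C * R * D * (1 - t) ^ a) (Ioo 0 1) := by
      have h1 : IntervalIntegrable (fun t : ℝ => (1 - t) ^ a) volume 0 1 := by
        have := (intervalIntegral.intervalIntegrable_rpow' (a := 1) (b := 0) ha1).comp_sub_left 1
        simpa using this
      exact (((intervalIntegrable_iff_integrableOn_Ioo_of_le zero_le_one).1 h1).const_mul _)
    have hle : ∀ t ∈ Ioo (0 : ℝ) 1,
        lam (γ.toFun t) * ‖deriv γ.toFun t‖ ≤ C * R * D * (1 - t) ^ a := by
      intro t ht
      have ht' : t ∈ Ico (0 : ℝ) 1 := ⟨ht.1.le, ht.2⟩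
      have h1t : 0 < 1 - t := by linarith [ht.2]
      have hd : deriv γ.toFun t = w * X (Φ (t • w)) := (hderiv t ht').deriv
      have hb := hbound U h F Φ R hU hh hF0 homit hΦ _ (hmem t ht')
      rw [norm_smul, Real.norm_of_nonneg ht.1.le, hw,
        show R - t * R = R * (1 - t) by ring, mul_pow R] at hb
      rw [hd, norm_mul, hw]
      change lam (Φ (t • w)) * _ ≤ _
      set p := Φ (t • w)
      set y : ℝ := ‖X p‖ * ‖F p‖ * (1 + ‖h p‖) ^ m with hy
      have hy0 : 0 ≤ y := by positivity
      have hyD : y ≤ D * (1 - t) ^ a := by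
        refine le_of_pow_le_pow_left₀ (n := 1 + s) (by lia) (by positivity) ?_
        rw [mul_pow D, ← Real.rpow_natCast ((1 - t) ^ a), ← Real.rpow_mul h1t.le,
          show a * ((1 + s : ℕ) : ℝ) = -(s : ℝ) by rw [ha]; push_cast; field_simp,
          Real.rpow_neg h1t.le, Real.rpow_natCast, ← div_eq_mul_inv, le_div_iff₀ (by positivity)]
        have h4 : y ^ (1 + s) * (1 - t) ^ s ≤ B / R ^ s := by
          rw [le_div_iff₀ (by positivity)]
          linarith
        exact h4.trans ((le_max_right _ _).trans (le_self_pow₀ hD1 (by lia)))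
      calc lam p * (R * ‖X p‖) ≤ C * ((1 + ‖h p‖) ^ m * ‖F p‖) * (R * ‖X p‖) := by
            gcongr
            exact hlam p (hΦ _ (hmem t ht')).1
        _ = C * R * y := by rw [hy]; ring
        _ ≤ C * R * (D * (1 - t) ^ a) := by gcongr
        _ = _ := by ring
    refine ne_of_lt (lt_of_le_of_lt ?_ (Integrable.lintegral_lt_top hintegrable))
    rw [pathLen]
    exact setLIntegral_mono' measurableSet_Ioo fun t ht => ENNReal.ofReal_le_ofReal (hle t ht)

/-- A holomorphic function on the complement of the zeros of `h`, whose norm extends continuously,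
extends holomorphically across the zeros. -/
theorem exists_differentiableOn_norm_eq {U : Set ℂ} (hU : IsOpen U) (hUc : IsPreconnected U)
    {h f : ℂ → ℂ} {κ : ℂ → ℝ} (hh : DifferentiableOn ℂ h U) (hne : ∃ z ∈ U, h z ≠ 0)
    (hf : ∀ z ∈ U, h z ≠ 0 → DifferentiableAt ℂ f z) (hκ : ContinuousOn κ U)
    (hfκ : ∀ z ∈ U, h z ≠ 0 → ‖f z‖ = κ z) :
    ∃ F : ℂ → ℂ, DifferentiableOn ℂ F U ∧ ∀ z ∈ U, ‖F z‖ = κ z := by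
  classical
  have hha := hh.analyticOnNhd hU
  set F : ℂ → ℂ := fun z => if h z = 0 then limUnder (𝓝[≠] z) f else f z with hFdef
  have hFd : DifferentiableOn ℂ F U := by
    intro z hz
    refine DifferentiableAt.differentiableWithinAt ?_
    by_cases hz0 : h z = 0
    · have hiso : ∀ᶠ w in 𝓝[≠] z, h w ≠ 0 := by
        refine (hha z hz).eventually_eq_zero_or_eventually_ne_zero.resolve_left fun h0 => ?_
        obtain ⟨w, hw, hw0⟩ := hne
        exact hw0 (hha.eqOn_zero_of_preconnected_of_eventuallyEq_zero hUc hz h0 hw)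
      have hS : ∀ᶠ w in 𝓝 z, (w ≠ z → h w ≠ 0) ∧ w ∈ U ∧ κ w < κ z + 1 :=
        (eventually_nhdsWithin_iff.1 hiso).and ((hU.eventually_mem hz).and
          ((hκ.continuousAt (hU.mem_nhds hz)).eventually_lt_const (lt_add_one _)))
      set S : Set ℂ := {w | (w ≠ z → h w ≠ 0) ∧ w ∈ U ∧ κ w < κ z + 1}
      have hupd := Complex.differentiableOn_update_limUnder_of_bddAbove (f := f) (s := S) (c := z) hS
        (fun w hw => (hf w hw.1.2.1 (hw.1.1 hw.2)).differentiableWithinAt)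
        ⟨κ z + 1, by
          rintro _ ⟨w, hw, rfl⟩
          rw [Function.comp_apply, hfκ w hw.1.2.1 (hw.1.1 hw.2)]
          exact hw.1.2.2.le⟩
      refine (hupd.differentiableAt hS).congr_of_eventuallyEq ?_
      filter_upwards [hS] with w hw
      by_cases hwz : w = z
      · subst hwz
        simp [hFdef, hz0]
      · simp [hFdef, hwz, hw.1 hwz]
    · refine (hf z hz hz0).congr_of_eventuallyEq ?_
      filter_upwards [(hha z hz).continuousAt.eventually_ne hz0] with w hw
      simp [hFdef, hw]
  refine ⟨F, hFd, fun z hz => ?_⟩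
  by_cases hz0 : h z = 0
  · have hiso : ∀ᶠ w in 𝓝[≠] z, h w ≠ 0 := by
      refine (hha z hz).eventually_eq_zero_or_eventually_ne_zero.resolve_left fun h0 => ?_
      obtain ⟨w, hw, hw0⟩ := hne
      exact hw0 (hha.eqOn_zero_of_preconnected_of_eventuallyEq_zero hUc hz h0 hw)
    have h1 : Tendsto (fun w => ‖F w‖) (𝓝[≠] z) (𝓝 ‖F z‖) :=
      ((hFd.differentiableAt (hU.mem_nhds hz)).continuousAt.norm).tendsto.mono_left
        nhdsWithin_le_nhds
    have h2 : Tendsto κ (𝓝[≠] z) (𝓝 (κ z)) :=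
      (hκ.continuousAt (hU.mem_nhds hz)).tendsto.mono_left nhdsWithin_le_nhds
    refine tendsto_nhds_unique h1 (h2.congr' ?_)
    filter_upwards [hiso, nhdsWithin_le_nhds (hU.mem_nhds hz)] with w hw hwU
    simp only [hFdef, if_neg hw]
    exact (hfκ w hwU hw).symm
  · simp only [hFdef, if_neg hz0]
    exact hfκ z hz hz0

/-- The coordinate on the Riemann sphere minus `x` which sends `x` to infinity. -/
def puncturedChart : OnePoint ℂ → OnePoint ℂ → ℂ
  | OnePoint.infty, y => y.elim 0 id
  | (a : ℂ), y => y.elim 0 fun c => (c - a)⁻¹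

theorem puncturedChart_injOn (x : OnePoint ℂ) : InjOn (puncturedChart x) {x}ᶜ := by
  intro y hy y' hy' h
  rw [mem_compl_singleton_iff] at hy hy'
  induction x using OnePoint.rec with
  | infty =>
    obtain ⟨c, rfl⟩ := OnePoint.ne_infty_iff_exists.1 hy
    obtain ⟨c', rfl⟩ := OnePoint.ne_infty_iff_exists.1 hy'
    exact congrArg _ h
  | coe a =>
    induction y using OnePoint.rec with
    | infty =>
      induction y' using OnePoint.rec with
      | infty => rfl
      | coe c' =>
        have h' : (0 : ℂ) = (c' - a)⁻¹ := h
        rw [eq_comm, inv_eq_zero, sub_eq_zero] at h'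
        exact absurd (congrArg _ h') hy'
    | coe c =>
      induction y' using OnePoint.rec with
      | infty =>
        have h' : (c - a)⁻¹ = (0 : ℂ) := h
        rw [inv_eq_zero, sub_eq_zero] at h'
        exact absurd (congrArg _ h') hy
      | coe c' =>
        have h' : (c - a)⁻¹ = (c' - a)⁻¹ := h
        rw [inv_inj, sub_left_inj] at h'
        exact congrArg _ h'

theorem SphHolomorphicOn.differentiableOn_puncturedChart {g : ℂ → OnePoint ℂ} {U : Set ℂ}
    (hU : IsOpen U) (hg : SphHolomorphicOn g U) {x : OnePoint ℂ} (hx : ∀ z ∈ U, g z ≠ x) :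
    DifferentiableOn ℂ (fun z => puncturedChart x (g z)) U := by
  intro z hz
  obtain ⟨V, hV, hzV, h, hh, hcase⟩ := hg z hz
  have hhz := hh.differentiableAt (hV.mem_nhds hzV)
  have hnhds : U ∩ V ∈ 𝓝 z := (hU.inter hV).mem_nhds ⟨hz, hzV⟩
  refine DifferentiableAt.differentiableWithinAt ?_
  induction x using OnePoint.rec with
  | infty =>
    rcases hcase with hc | hc
    · refine hhz.congr_of_eventuallyEq ?_
      filter_upwards [hnhds] with w hw
      rw [hc w hw.2]
      rfl
    · have hne : ∀ w ∈ U ∩ V, h w ≠ 0 := fun w hw h0 => hx w hw.1 (by rw [hc w hw.2, if_pos h0])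
      refine (hhz.inv (hne z ⟨hz, hzV⟩)).congr_of_eventuallyEq ?_
      filter_upwards [hnhds] with w hw
      rw [hc w hw.2, if_neg (hne w hw)]
      rfl
  | coe a =>
    rcases hcase with hc | hc
    · have hne : ∀ w ∈ U ∩ V, h w - a ≠ 0 := fun w hw h0 =>
        hx w hw.1 (by rw [hc w hw.2, sub_eq_zero.1 h0])
      refine ((hhz.sub_const a).inv (hne z ⟨hz, hzV⟩)).congr_of_eventuallyEq ?_
      filter_upwards [hnhds] with w hw
      rw [hc w hw.2]
      rfl
    · have hne : ∀ w ∈ U ∩ V, 1 - a * h w ≠ 0 := by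
        intro w hw h0
        have h1 : h w ≠ 0 := by
          rintro h1
          simp [h1] at h0
        refine hx w hw.1 ?_
        rw [hc w hw.2, if_neg h1, inv_eq_of_mul_eq_one_left (sub_eq_zero.1 h0).symm]
      refine (hhz.div ((hhz.const_mul a).const_sub 1) (hne z ⟨hz, hzV⟩)).congr_of_eventuallyEq ?_
      filter_upwards [hnhds] with w hw
      rw [hc w hw.2]
      split_ifs with h1
      · simp only [Pi.div_apply, h1, zero_div]
        rfl
      · change ((h w)⁻¹ - a)⁻¹ = h w / (1 - a * h w)
        rw [← inv_div]
        congr 1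
        field_simp

namespace WeierstrassTriple

variable {m : ℕ} {U : Set ℂ}

/-- In the coordinate on the sphere punctured at an omitted value of `g`, the metric is dominated by
`(1 + |h|) ^ m |F| |dz|` with `F` holomorphic and nowhere zero. -/
theorem exists_lam_le (T : WeierstrassTriple m U) (hnc : ∃ z ∈ U, ∃ w ∈ U, T.g z ≠ T.g w)
    {x : OnePoint ℂ} (hx : ∀ z ∈ U, T.g z ≠ x) :
    ∃ F : ℂ → ℂ, ∃ C : ℝ, 0 ≤ C ∧ DifferentiableOn ℂ F U ∧ (∀ z ∈ U, F z ≠ 0) ∧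
      ∀ z ∈ U, T.lam z ≤ C * ((1 + ‖puncturedChart x (T.g z)‖) ^ m * ‖F z‖) := by
  have hsq : ∀ y b : ℝ, 0 ≤ y → 0 ≤ b → y ≤ b ^ 2 → y ^ ((m : ℝ) / 2) ≤ b ^ m := by
    intro y b hy hb hyb
    calc y ^ ((m : ℝ) / 2) ≤ (b ^ 2) ^ ((m : ℝ) / 2) := by gcongr
      _ = b ^ m := by
        rw [← Real.rpow_natCast, ← Real.rpow_mul hb, ← Real.rpow_natCast]
        congr 1
        push_cast
        ring
  have hh := T.g_holo.differentiableOn_puncturedChart T.isOpen hx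
  obtain ⟨z₁, hz₁, z₂, hz₂, hz₁₂⟩ := hnc
  have hne12 : puncturedChart x (T.g z₁) ≠ puncturedChart x (T.g z₂) := fun he =>
    hz₁₂ (puncturedChart_injOn x (hx z₁ hz₁) (hx z₂ hz₂) he)
  induction x using OnePoint.rec with
  | infty =>
    refine ⟨T.f, 1, zero_le_one, T.f_holo, fun z hz h0 => ?_, fun z hz => ?_⟩
    all_goals
      obtain ⟨c, hc⟩ := OnePoint.ne_infty_iff_exists.1 (hx z hz)
      have hl := T.lam_eq z hz c hc.symm
    · rw [h0, norm_zero, mul_zero] at hl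
      exact (T.lam_pos z hz).ne' hl
    · rw [hl, ← hc, one_mul]
      change _ ≤ (1 + ‖c‖) ^ m * _
      gcongr
      exact hsq _ _ (by positivity) (by positivity) (by nlinarith [norm_nonneg c])
  | coe a =>
    set h : ℂ → ℂ := fun z => puncturedChart (a : OnePoint ℂ) (T.g z) with hdef
    set q : ℂ → ℝ := fun z => ‖h z‖ ^ 2 + ‖1 + a * h z‖ ^ 2 with hq
    have hqpos : ∀ z, 0 < q z := by
      intro z
      by_cases hz : h z = 0
      · simp [hq, hz]
      · have := norm_pos_iff.2 hz
        simp only [hq]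
        positivity
    have hκ : ContinuousOn (fun z => T.lam z / q z ^ ((m : ℝ) / 2)) U := by
      have hc := hh.continuousOn
      refine T.lam_cont.div (ContinuousOn.rpow_const ?_ fun z _ => Or.inl (hqpos z).ne')
        fun z _ => (Real.rpow_pos_of_pos (hqpos z) _).ne'
      exact (hc.norm.pow 2).add ((continuousOn_const.add (continuousOn_const.mul hc)).norm.pow 2)
    obtain ⟨F, hF, hFκ⟩ := exists_differentiableOn_norm_eq T.isOpen T.isConnected.isPreconnected
      (f := fun z => T.f z / h z ^ m) hh
      (by
        by_contra! hcon
        exact hne12 ((hcon z₁ hz₁).trans (hcon z₂ hz₂).symm))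
      (fun z hz hz0 => (T.f_holo.differentiableAt (T.isOpen.mem_nhds hz)).div
        ((hh.differentiableAt (T.isOpen.mem_nhds hz)).pow m) (pow_ne_zero _ hz0)) hκ
      (by
        intro z hz hz0
        have hfin : T.g z ≠ OnePoint.infty := by
          intro hinf
          apply hz0
          simp only [hdef, hinf]
          rfl
        obtain ⟨c, hc⟩ := OnePoint.ne_infty_iff_exists.1 hfin
        have hhc : h z = (c - a)⁻¹ := by
          simp only [hdef, ← hc]
          rfl
        have hca : c = (1 + a * h z) / h z := by
          rw [eq_div_iff hz0, hhc]
          rw [hhc, ne_eq, inv_eq_zero] at hz0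
          field_simp
          ring
        have hpos := norm_pos_iff.2 hz0
        have hsq' : 1 + ‖c‖ ^ 2 = q z / ‖h z‖ ^ 2 := by
          rw [hca, norm_div]
          simp only [hq]
          field_simp
        have hpow : (‖h z‖ ^ 2) ^ ((m : ℝ) / 2) = ‖h z‖ ^ m := by
          rw [← Real.rpow_natCast, ← Real.rpow_mul hpos.le, ← Real.rpow_natCast]
          congr 1
          push_cast
          ring
        rw [T.lam_eq z hz c hc.symm, hsq', Real.div_rpow (hqpos z).le (by positivity), hpow,
          norm_div, norm_pow]
        have := Real.rpow_pos_of_pos (hqpos z) ((m : ℝ) / 2)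
        field_simp)
    refine ⟨F, (1 + ‖a‖) ^ m, by positivity, hF, fun z hz h0 => ?_, fun z hz => ?_⟩
    · have h1 := hFκ z hz
      rw [h0, norm_zero] at h1
      exact (div_pos (T.lam_pos z hz) (Real.rpow_pos_of_pos (hqpos z) _)).ne h1
    · have hqm := Real.rpow_pos_of_pos (hqpos z) ((m : ℝ) / 2)
      have h1 : T.lam z = q z ^ ((m : ℝ) / 2) * ‖F z‖ := by
        rw [hFκ z hz]
        field_simp
      rw [h1, ← mul_assoc, ← mul_pow]
      gcongr
      refine hsq _ _ (hqpos z).le (by positivity) ?_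
      change ‖h z‖ ^ 2 + ‖1 + a * h z‖ ^ 2 ≤ ((1 + ‖a‖) * (1 + ‖h z‖)) ^ 2
      have h2 : ‖1 + a * h z‖ ≤ 1 + ‖a‖ * ‖h z‖ := by
        simpa using norm_add_le (1 : ℂ) (a * h z)
      have h3 : ‖1 + a * h z‖ ^ 2 ≤ (1 + ‖a‖ * ‖h z‖) ^ 2 := by gcongr
      have h4 : (1 + ‖a‖ * ‖h z‖) ^ 2 + ‖h z‖ ^ 2 ≤ (1 + ‖a‖ * ‖h z‖ + ‖h z‖) ^ 2 := by
        have : 0 ≤ (1 + ‖a‖ * ‖h z‖) * ‖h z‖ := by positivity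
        nlinarith
      have h5 : (1 + ‖a‖ * ‖h z‖ + ‖h z‖) ^ 2 ≤ ((1 + ‖a‖) * (1 + ‖h z‖)) ^ 2 := by
        gcongr
        nlinarith [norm_nonneg a]
      linarith

end WeierstrassTriple

/-- Picard-type theorem for Weierstrass `m`-triples: if the metric is complete and `g` is
nonconstant, then `g` omits at most `m + 2` values of the Riemann sphere. -/
theorem picard_weierstrass (m : ℕ) (hm : 0 < m) (U : Set ℂ)
    (T : WeierstrassTriple m U) (hcomp : IsCompleteMetric T.lam U)
    (hnc : ∃ z ∈ U, ∃ w ∈ U, T.g z ≠ T.g w) :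
    ((Set.univ : Set (OnePoint ℂ)) \ T.g '' U).encard ≤ (m : ℕ∞) + 2 := by
  classical
  by_contra! hlt
  have hle : ((m + 2 + 1 : ℕ) : ℕ∞) ≤ ((Set.univ : Set (OnePoint ℂ)) \ T.g '' U).encard := by
    push_cast
    exact Order.add_one_le_of_lt hlt
  obtain ⟨S, hS, hScard⟩ := Set.exists_subset_encard_eq hle
  have hSfin : S.Finite := Set.finite_of_encard_eq_coe hScard
  obtain ⟨S, rfl⟩ := hSfin.exists_finset_coe
  rw [Set.encard_coe_eq_coe_finsetCard, Nat.cast_inj] at hScard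
  obtain ⟨x, hxS⟩ : S.Nonempty := Finset.card_pos.1 (by lia)
  have homit : ∀ y ∈ S, ∀ z ∈ U, T.g z ≠ y := fun y hy z hz h => (hS hy).2 ⟨z, hz, h⟩
  have hinj := puncturedChart_injOn x
  have hsub : ((S.erase x : Finset (OnePoint ℂ)) : Set (OnePoint ℂ)) ⊆ {x}ᶜ := fun y hy =>
    Finset.ne_of_mem_erase hy
  obtain ⟨F, C, hC, hF, hF0, hlam⟩ := T.exists_lam_le hnc (homit x hxS)
  obtain ⟨p, hp, γ, hγ⟩ := exists_divergentPath_pathLen_ne_top hm T.isOpen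
    T.isConnected.isPreconnected hC
    (T.g_holo.differentiableOn_puncturedChart T.isOpen (homit x hxS)) hF hF0
    (A := (S.erase x).image (puncturedChart x))
    (by
      rw [Finset.card_image_of_injOn (hinj.mono hsub), Finset.card_erase_of_mem hxS, hScard]
      rfl)
    (by
      intro z hz hmem
      obtain ⟨y, hy, hyz⟩ := Finset.mem_image.1 hmem
      exact homit y (Finset.mem_of_mem_erase hy) z hz
        (hinj (homit x hxS z hz) (hsub hy) hyz.symm))
    (by
      obtain ⟨z, hz, w, hw, hzw⟩ := hnc
      exact ⟨z, hz, w, hw, fun h => hzw (hinj (homit x hxS z hz) (homit x hxS w hw) h)⟩)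
    hlam
  exact hγ (hcomp p hp γ)

end
end

section
/- (Sharpness of the Picard-type theorem) Let m be a positive integer and let α₁, …, α_{m+1} be distinct complex numbers. Set Σ = ℂ \ {α₁, …, α_{m+1}}, f dz = dz / ∏_{j=1}^{m+1}(z − α_j), and g(z) = z. Then (Σ, f dz, g) is a Weierstrass m-triple whose nonconstant function g omits the m + 2 distinct values α₁, …, α_{m+1}, ∞, and the metric ds² = (1+|g|²)^m |f|² |dz|² is complete on Σ; in particular, ∫_γ (1+|z|²)^{m/2} / ∏_{j=1}^{m+1}|z − α_j| |dz| = +∞ for every curve γ in Σ tending to one of the points α₁, …, α_{m+1}, ∞. -/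
open Filter Set MeasureTheory Topology
open scoped ENNReal

noncomputable section

/-- A real function differentiable on `(a, b)` varies by at most the integral of `|h'|`. -/
theorem abs_sub_le_toReal_of_lintegral_deriv_le {h : ℝ → ℝ} {a b s t : ℝ} {C : ℝ≥0∞}
    (hd : ∀ x ∈ Ioo a b, DifferentiableAt ℝ h x) (hC : C ≠ ⊤)
    (hint : ∫⁻ x in Ioo a b, ‖deriv h x‖ₑ ≤ C) (hs : s ∈ Ioo a b) (ht : t ∈ Ioo a b) :
    |h t - h s| ≤ C.toReal := by
  have hI : IntegrableOn (deriv h) (Ioo a b) :=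
    ⟨(measurable_deriv h).aestronglyMeasurable, hint.trans_lt hC.lt_top⟩
  have hsub : uIcc s t ⊆ Ioo a b := ordConnected_Ioo.uIcc_subset hs ht
  have hsub' : uIoc s t ⊆ Ioo a b := uIoc_subset_uIcc.trans hsub
  have hftc : ∫ x in s..t, deriv h x = h t - h s :=
    intervalIntegral.integral_eq_sub_of_hasDerivAt
      (fun x hx => (hd x (hsub hx)).hasDerivAt)
      (intervalIntegrable_iff.2 (hI.mono_set hsub'))
  rw [← hftc, ← Real.norm_eq_abs, intervalIntegral.norm_intervalIntegral_eq, ← toReal_enorm]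
  exact ENNReal.toReal_mono hC
    ((enorm_integral_le_lintegral_enorm _).trans ((lintegral_mono_set hsub').trans hint))

/-- The density of the metric `(1+|z|²)^m |dz|² / ∏ |z - αⱼ|²`. -/
def picardDensity {m : ℕ} (α : Fin (m + 1) → ℂ) (z : ℂ) : ℝ :=
  (1 + ‖z‖ ^ 2) ^ ((m : ℝ) / 2) * ‖(∏ j, (z - α j))⁻¹‖

theorem prod_sub_ne_zero {m : ℕ} {α : Fin (m + 1) → ℂ} {z : ℂ} (hz : z ∈ (range α)ᶜ) :
    ∏ j, (z - α j) ≠ 0 :=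
  Finset.prod_ne_zero_iff.2 fun j _ h => hz ⟨j, (sub_eq_zero.1 h).symm⟩

/-- The density dominates that of a flat cylinder around each puncture, uniformly on the plane. -/
theorem exists_inv_norm_sub_le_picardDensity {m : ℕ} (α : Fin (m + 1) → ℂ) :
    ∃ M : ℝ, 0 < M ∧ ∀ z ∈ (range α)ᶜ, ∀ j, ‖z - α j‖⁻¹ ≤ M * picardDensity α z := by
  set A : ℝ := ∑ i, ‖α i‖
  have hA0 : 0 ≤ A := Finset.sum_nonneg fun i _ => norm_nonneg _
  refine ⟨(1 + A) ^ m, by positivity, fun z hz j => ?_⟩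
  set s : ℝ := √(1 + ‖z‖ ^ 2) with hs
  have hs1 : 1 ≤ s := Real.one_le_sqrt.2 (by nlinarith [sq_nonneg ‖z‖])
  have hzs : ‖z‖ ≤ s := Real.le_sqrt_of_sq_le (by linarith)
  have hpow : (1 + ‖z‖ ^ 2) ^ ((m : ℝ) / 2) = s ^ m := by
    rw [hs, Real.sqrt_eq_rpow, ← Real.rpow_natCast _ m, ← Real.rpow_mul (by positivity)]
    congr 1
    ring
  have hfac (i) : ‖z - α i‖ ≤ (1 + A) * s := by
    have h1 : ‖α i‖ ≤ A := Finset.single_le_sum (f := fun i => ‖α i‖)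
      (fun i _ => norm_nonneg _) (Finset.mem_univ i)
    nlinarith [norm_sub_le z (α i)]
  have hprod : ∏ i : Fin m, ‖z - α (j.succAbove i)‖ ≤ (1 + A) ^ m * s ^ m := by
    rw [← mul_pow]
    simpa using Finset.prod_le_prod (s := Finset.univ) (fun i _ => norm_nonneg _)
      (fun (i : Fin m) _ => hfac (j.succAbove i))
  have hpos (i) : 0 < ‖z - α i‖ :=
    norm_pos_iff.2 fun h => hz ⟨i, (sub_eq_zero.1 h).symm⟩
  have hQ : 0 < ∏ i : Fin m, ‖z - α (j.succAbove i)‖ := Finset.prod_pos fun i _ => hpos _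
  rw [picardDensity, hpow, norm_inv, norm_prod, Fin.prod_univ_succAbove _ j, ← mul_assoc,
    ← div_eq_mul_inv, le_div_iff₀ (mul_pos (hpos j) hQ), inv_mul_cancel_left₀ (hpos j).ne']
  exact hprod

theorem isCompact_annuli {ι : Type*} [Nonempty ι] (α : ι → ℂ) (r R : ι → ℝ) :
    IsCompact {z : ℂ | ∀ j, ‖z - α j‖ ^ 2 ∈ Icc (r j) (R j)} := by
  refine Metric.isCompact_of_isClosed_isBounded ?_ ?_
  · simp only [ofPred_forall]
    exact isClosed_iInter fun j => isClosed_Icc.preimage (by fun_prop)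
  · obtain ⟨j⟩ := ‹Nonempty ι›
    refine (Metric.isBounded_closedBall (x := α j) (r := √(R j))).subset fun z hz => ?_
    rw [mem_closedBall_iff_norm]
    exact Real.le_sqrt_of_sq_le (hz j).2

theorem hasDerivAt_log_norm_sq_sub {γ : ℝ → ℂ} {γ' a : ℂ} {t : ℝ} (h : HasDerivAt γ γ' t)
    (ha : γ t ≠ a) :
    HasDerivAt (fun u => Real.log (‖γ u - a‖ ^ 2))
      (2 * inner ℝ (γ t - a) γ' / ‖γ t - a‖ ^ 2) t :=
  (h.sub_const a).norm_sq.log (by simpa [sub_eq_zero] using ha)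

theorem abs_deriv_log_norm_sq_sub_le {γ : ℝ → ℂ} {a : ℂ} {t : ℝ} (h : DifferentiableAt ℝ γ t)
    (ha : γ t ≠ a) :
    |deriv (fun u => Real.log (‖γ u - a‖ ^ 2)) t| ≤ 2 * (‖γ t - a‖⁻¹ * ‖deriv γ t‖) := by
  have hpos : 0 < ‖γ t - a‖ := norm_pos_iff.2 (sub_ne_zero.2 ha)
  rw [(hasDerivAt_log_norm_sq_sub h.hasDerivAt ha).deriv, abs_div, abs_mul, abs_two,
    abs_of_pos (pow_pos hpos 2), div_le_iff₀ (pow_pos hpos 2)]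
  calc 2 * |inner ℝ (γ t - a) (deriv γ t)| ≤ 2 * (‖γ t - a‖ * ‖deriv γ t‖) := by
        gcongr
        exact abs_real_inner_le_norm _ _
    _ = 2 * (‖γ t - a‖⁻¹ * ‖deriv γ t‖) * ‖γ t - a‖ ^ 2 := by field_simp

theorem isCompleteMetric_picardDensity {m : ℕ} (α : Fin (m + 1) → ℂ) :
    IsCompleteMetric (picardDensity α) (range α)ᶜ := by
  intro p _ γ
  by_contra hfin
  obtain ⟨M, hM, hbound⟩ := exists_inv_norm_sub_le_picardDensity α
  have hmem {t : ℝ} (ht : t ∈ Ioo (0 : ℝ) 1) : γ.toFun t ∈ (range α)ᶜ :=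
    γ.mem t (Ioo_subset_Ico_self ht)
  have hne {t : ℝ} (ht : t ∈ Ioo (0 : ℝ) 1) (j) : γ.toFun t ≠ α j :=
    fun h => hmem ht ⟨j, h.symm⟩
  set C : ℝ≥0∞ := ENNReal.ofReal (2 * M) * pathLen (picardDensity α) γ.toFun
  have hC : C ≠ ⊤ := ENNReal.mul_ne_top ENNReal.ofReal_ne_top hfin
  set h : Fin (m + 1) → ℝ → ℝ := fun j u => Real.log (‖γ.toFun u - α j‖ ^ 2)
  have hvar (j) {t : ℝ} (ht : t ∈ Ioo (0 : ℝ) 1) : |h j t - h j (1 / 2)| ≤ C.toReal := by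
    refine abs_sub_le_toReal_of_lintegral_deriv_le (a := 0) (b := 1) (fun x hx =>
      (hasDerivAt_log_norm_sq_sub (γ.diff x hx).hasDerivAt (hne hx j)).differentiableAt)
      hC ?_ (by norm_num) ht
    rw [show C = _ from (lintegral_const_mul' _ _ ENNReal.ofReal_ne_top).symm]
    refine setLIntegral_mono' measurableSet_Ioo fun x hx => ?_
    rw [← ENNReal.ofReal_mul (by positivity), Real.enorm_eq_ofReal_abs]
    refine ENNReal.ofReal_le_ofReal ((abs_deriv_log_norm_sq_sub_le (γ.diff x hx) (hne hx j)).trans ?_)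
    rw [mul_assoc, ← mul_assoc M]
    gcongr
    exact hbound _ (hmem hx) j
  obtain ⟨t₀, ht₀, hout⟩ := γ.divergent _
    (isCompact_annuli α (fun j => Real.exp (h j (1 / 2) - C.toReal))
      (fun j => Real.exp (h j (1 / 2) + C.toReal))) (by
      rintro _ hz ⟨j, rfl⟩
      have := (hz j).1
      simp only [sub_self, norm_zero] at this
      linarith [Real.exp_pos (h j (1 / 2) - C.toReal)])
  have ht : max t₀ (1 / 2) ∈ Ioo (0 : ℝ) 1 :=
    ⟨lt_max_of_lt_right (by norm_num), max_lt ht₀.2 (by norm_num)⟩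
  refine hout _ (le_max_left _ _) ht.2 fun j => ?_
  have hpos : 0 < ‖γ.toFun (max t₀ (1 / 2)) - α j‖ ^ 2 :=
    pow_pos (norm_pos_iff.2 (sub_ne_zero.2 (hne ht j))) 2
  have habs := abs_le.1 (hvar j ht)
  rw [mem_Icc, ← Real.le_log_iff_exp_le hpos, ← Real.log_le_iff_le_exp hpos]
  exact ⟨by linarith [habs.1], by linarith [habs.2]⟩

theorem isConnected_compl_range {ι : Type*} [Finite ι] (α : ι → ℂ) : IsConnected (range α)ᶜ :=
  (finite_range α).countable.isConnected_compl_of_one_lt_rank (by simp)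

/-- The Weierstrass triple with `f dz = dz / ∏ (z - αⱼ)` and `g(z) = z`. -/
def picardTriple {m : ℕ} (α : Fin (m + 1) → ℂ) : WeierstrassTriple m (range α)ᶜ where
  isOpen := (finite_range α).isClosed.isOpen_compl
  isConnected := isConnected_compl_range α
  f z := (∏ j, (z - α j))⁻¹
  g z := (z : OnePoint ℂ)
  f_holo := DifferentiableOn.inv (by fun_prop) fun _ hz => prod_sub_ne_zero hz
  g_holo _ _ := ⟨univ, isOpen_univ, mem_univ _, id, differentiableOn_id, Or.inl fun _ _ => rfl⟩
  g_mero := (isConnected_compl_range α).nonempty.imp fun _ hz => ⟨hz, OnePoint.coe_ne_infty _⟩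
  lam := picardDensity α
  lam_cont := by
    refine ContinuousOn.mul (Continuous.continuousOn ?_) (ContinuousOn.norm ?_)
    · exact Continuous.rpow_const (by fun_prop) fun z => Or.inl (by positivity)
    · exact ContinuousOn.inv₀ (by fun_prop) fun _ hz => prod_sub_ne_zero hz
  lam_pos z hz := by
    have := norm_pos_iff.2 (inv_ne_zero (prod_sub_ne_zero hz))
    unfold picardDensity
    positivity
  lam_eq z _ w hw := by
    rw [← OnePoint.coe_injective hw]
    rfl

/-- Sharpness of the Picard-type theorem: on `Σ = ℂ \ {α₁, …, α_{m+1}}` with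
`f dz = dz / ∏ (z - αⱼ)` and `g(z) = z`, one obtains a Weierstrass `m`-triple with
complete metric whose nonconstant `g` omits the `m + 2` values `α₁, …, α_{m+1}, ∞`. -/
theorem picard_weierstrass_sharp (m : ℕ) (hm : 0 < m)
    (α : Fin (m + 1) → ℂ) (hα : Function.Injective α) :
    ∃ T : WeierstrassTriple m (Set.range α)ᶜ,
      (∀ z ∈ (Set.range α)ᶜ, T.f z = (∏ j, (z - α j))⁻¹) ∧
      (∀ z ∈ (Set.range α)ᶜ, T.g z = (z : OnePoint ℂ)) ∧
      IsCompleteMetric T.lam (Set.range α)ᶜ ∧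
      (∃ z ∈ (Set.range α)ᶜ, ∃ w ∈ (Set.range α)ᶜ, T.g z ≠ T.g w) ∧
      (∀ j, (α j : OnePoint ℂ) ∉ T.g '' (Set.range α)ᶜ) ∧
      OnePoint.infty ∉ T.g '' (Set.range α)ᶜ ∧
      (m : ℕ∞) + 2 ≤ ((Set.univ : Set (OnePoint ℂ)) \ T.g '' (Set.range α)ᶜ).encard := by
  have hcoe (j) : (α j : OnePoint ℂ) ∉ (picardTriple α).g '' (range α)ᶜ := by
    rintro ⟨z, hz, h⟩
    exact hz ⟨j, (OnePoint.coe_injective h).symm⟩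
  have hinfty : OnePoint.infty ∉ (picardTriple α).g '' (range α)ᶜ := by
    rintro ⟨z, -, h⟩
    exact OnePoint.coe_ne_infty z h
  refine ⟨picardTriple α, fun _ _ => rfl, fun _ _ => rfl, isCompleteMetric_picardDensity α, ?_,
    hcoe, hinfty, ?_⟩
  · have hnt : ((range α)ᶜ).Nontrivial := (finite_range α).infinite_compl.nontrivial
    obtain ⟨z, hz, w, hw, hzw⟩ := hnt
    exact ⟨z, hz, w, hw, fun h => hzw (OnePoint.coe_injective h)⟩
  · have hsub : insert OnePoint.infty (range (((↑) : ℂ → OnePoint ℂ) ∘ α)) ⊆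
        univ \ (picardTriple α).g '' (range α)ᶜ := by
      rintro _ (rfl | ⟨j, rfl⟩)
      exacts [⟨mem_univ _, hinfty⟩, ⟨mem_univ _, hcoe j⟩]
    refine le_trans (le_of_eq ?_) (encard_le_encard hsub)
    rw [encard_insert_of_notMem (by rintro ⟨j, h⟩; exact OnePoint.coe_ne_infty _ h), ← image_univ,
      (OnePoint.coe_injective.comp hα).encard_image]
    simp [add_assoc, one_add_one_eq_two]

end
end

section
/- (Pointwise curvature estimate at the center) For every L > 0 and every positive integer m, the constant C := √(2m) · L · (1 + L²)^{m/2} has the following property: for every R > 0 and every Weierstrass m-triple (D(0;R), f dz, g) on the disk D(0;R) = {z ∈ ℂ : |z| < R} satisfying |g| < L on D(0;R), one has |K_{ds²}(0)|^{1/2} ≤ C / d(0), where K_{ds²}(0) is the Gaussian curvature of the metric ds² = (1+|g|²)^m |f|² |dz|² at 0 and d(0) is the geodesic distance from 0 to the boundary ∂D(0;R) with respect to ds². -/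
open Filter Set MeasureTheory Topology
open scoped ENNReal

noncomputable section

section RayLifting

variable {E X : Type*} [TopologicalSpace E] [TopologicalSpace X]

/-- `γ` is a continuous lift of `c` through `p` on `s`, starting at `e₀`. -/
structure IsLiftOn (p : E → X) (c : ℝ → X) (e₀ : E) (γ : ℝ → E) (s : Set ℝ) : Prop where
  cont : ContinuousOn γ s
  start : γ 0 = e₀
  lifts : ∀ t ∈ s, p (γ t) = c t

omit [TopologicalSpace X] in
theorem IsLiftOn.mono {p : E → X} {c : ℝ → X} {e₀ : E} {γ : ℝ → E} {s t : Set ℝ}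
    (h : IsLiftOn p c e₀ γ t) (hst : s ⊆ t) : IsLiftOn p c e₀ γ s :=
  ⟨h.cont.mono hst, h.start, fun x hx => h.lifts x (hst hx)⟩

theorem IsLiftOn.eqOn {p : E → X} (hp : IsLocalHomeomorph p) (hsep : IsSeparatedMap p)
    {c : ℝ → X} {e₀ : E} {γ₁ γ₂ : ℝ → E} {T : ℝ} (hT : 0 ≤ T)
    (h₁ : IsLiftOn p c e₀ γ₁ (Icc 0 T)) (h₂ : IsLiftOn p c e₀ γ₂ (Icc 0 T)) :
    EqOn γ₁ γ₂ (Icc 0 T) :=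
  hsep.eqOn_of_comp_eqOn hp.isLocallyInjective isPreconnected_Icc h₁.cont h₂.cont
    (fun t ht => (h₁.lifts t ht).trans (h₂.lifts t ht).symm) (left_mem_Icc.2 hT)
    (h₁.start.trans h₂.start.symm)

/-- A lift on `[0, a]` ending in the source of a local inverse of `p` extends to `[0, b]` as long
as the base path stays in the domain of that local inverse on `[a, b]`. -/
theorem IsLiftOn.extend {e : OpenPartialHomeomorph E X} {c : ℝ → X} (hc : Continuous c) {e₀ : E}
    {γ : ℝ → E} {a b : ℝ} (ha : 0 ≤ a) (h : IsLiftOn e c e₀ γ (Icc 0 a))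
    (hγa : γ a ∈ e.source) (hcab : ∀ t ∈ Icc a b, c t ∈ e.target) :
    ∃ γ', IsLiftOn e c e₀ γ' (Icc 0 b) := by
  classical
  have hglue : e.symm (c a) = γ a := by
    rw [← h.lifts a (right_mem_Icc.2 ha), e.left_inv hγa]
  refine ⟨fun t => if t ≤ a then γ t else e.symm (c t), ?_, by simp [ha, h.start], ?_⟩
  · refine ContinuousOn.if (p := fun t : ℝ => t ≤ a) ?_ ?_ ?_
    · rintro t ⟨-, ht⟩
      have : t = a := by simpa using frontier_le_subset_eq continuous_id continuous_const ht
      rw [this, hglue]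
    · refine h.cont.mono ?_
      rintro t ⟨ht, hta⟩
      have hta' : t ∈ closure (Iic a) := hta
      rw [closure_Iic] at hta'
      exact ⟨ht.1, hta'⟩
    · refine (e.continuousOn_symm.comp hc.continuousOn (s := Icc a b) hcab).mono ?_
      rintro t ⟨ht, hta⟩
      have hta' : t ∈ closure (Ioi a) := by
        convert! hta using 2
        ext x
        simp
      rw [closure_Ioi] at hta'
      exact ⟨hta', ht.2⟩
  · intro t ht
    by_cases hta : t ≤ a
    · simpa [hta] using h.lifts t ⟨ht.1, hta⟩
    · simpa [hta] using e.right_inv (hcab t ⟨(not_le.1 hta).le, ht.2⟩)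

/-- Path lifting through a separated local homeomorphism: if no partial lift of `c` leaves every
compact set, then `c` has a lift on `[0, 1]`. -/
theorem exists_isLiftOn_Icc {p : E → X} (hp : IsLocalHomeomorph p) (hsep : IsSeparatedMap p)
    {c : ℝ → X} (hc : Continuous c) {e₀ : E} (he₀ : p e₀ = c 0) [T2Space X]
    (hrec : ∀ T ∈ Ioc (0 : ℝ) 1, ∀ γ, IsLiftOn p c e₀ γ (Ico 0 T) →
      ∃ K : Set E, IsCompact K ∧ ∀ t₀ ∈ Ico 0 T, ∃ t ∈ Ico t₀ T, γ t ∈ K) :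
    ∃ γ, IsLiftOn p c e₀ γ (Icc 0 1) := by
  classical
  set A : Set ℝ := {T | T ∈ Icc (0 : ℝ) 1 ∧ ∃ γ, IsLiftOn p c e₀ γ (Icc 0 T)}
  have hA0 : (0 : ℝ) ∈ A :=
    ⟨by simp, fun _ => e₀, continuousOn_const, rfl, fun t ht => by
      rw [Icc_self] at ht
      rw [ht, he₀]⟩
  have hbdd : BddAbove A := ⟨1, fun T hT => hT.1.2⟩
  have hdown : ∀ T ∈ A, ∀ t ∈ Icc 0 T, t ∈ A := fun T ⟨hT, γ, hγ⟩ t ht =>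
    ⟨⟨ht.1, ht.2.trans hT.2⟩, γ, hγ.mono (Icc_subset_Icc_right ht.2)⟩
  have : Nonempty (ℝ → E) := ⟨fun _ => e₀⟩
  choose! lift hlift using fun T (hT : T ∈ A) => hT.2
  set S := sSup A
  have hS0 : 0 ≤ S := le_csSup hbdd hA0
  have hS1 : S ≤ 1 := csSup_le ⟨0, hA0⟩ fun T hT => hT.1.2
  have hlt : ∀ t ∈ Ico 0 S, ∃ T ∈ A, t < T := fun t ht => exists_lt_of_lt_csSup ⟨0, hA0⟩ ht.2
  -- a neighbourhood of `c S` over which partial lifts can be continued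
  have key : ∃ e : OpenPartialHomeomorph E X, p = e ∧ c S ∈ e.target ∧
      ∀ V : Set ℝ, V ∈ 𝓝 S → ∃ a ∈ A, a ∈ V ∧ a ≤ S ∧ lift a a ∈ e.source := by
    rcases hS0.eq_or_lt with h0 | hpos
    · obtain ⟨e, hes, rfl⟩ := hp e₀
      refine ⟨e, rfl, ?_, fun V hV => ⟨0, hA0, h0 ▸ mem_of_mem_nhds hV, hS0, ?_⟩⟩
      · rw [← h0, ← he₀]
        exact e.map_source hes
      · rw [(hlift 0 hA0).start]
        exact hes
    · have hmemA : ∀ t ∈ Ico 0 S, t ∈ A := fun t ht =>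
        let ⟨T, hT, htT⟩ := hlt t ht
        hdown T hT t ⟨ht.1, htT.le⟩
      have hdiag : ∀ T ∈ A, EqOn (fun t => lift t t) (lift T) (Icc 0 T) := fun T hT t ht =>
        (hlift t (hdown T hT t ht)).eqOn hp hsep ht.1
          ((hlift T hT).mono (Icc_subset_Icc_right ht.2)) (right_mem_Icc.2 ht.1)
      obtain ⟨K, hK, hKrec⟩ := hrec S ⟨hpos, hS1⟩ (fun t => lift t t)
        { cont := fun t ht => by
            obtain ⟨T, hT, htT⟩ := hlt t ht
            refine (((hlift T hT).cont.congr (hdiag T hT)) t ⟨ht.1, htT.le⟩).mono_of_mem_nhdsWithin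
              ?_
            filter_upwards [self_mem_nhdsWithin, mem_nhdsWithin_of_mem_nhds (Iio_mem_nhds htT)]
              with x hx hxT
            exact ⟨hx.1, hxT.le⟩
          start := (hlift 0 hA0).start
          lifts := fun t ht => (hlift t (hmemA t ht)).lifts t (right_mem_Icc.2 ht.1) }
      have hfreq : ∃ᶠ t in 𝓝[<] S, t ∈ Ico 0 S ∧ lift t t ∈ K := by
        rw [Filter.frequently_iff]
        intro V hV
        obtain ⟨l, hl, hlV⟩ := (mem_nhdsLT_iff_exists_Ioo_subset' hpos).1 hV
        have hm : (max 0 l + S) / 2 ∈ Ico 0 S := by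
          constructor
          · linarith [le_max_left 0 l]
          · linarith [max_lt hpos hl]
        obtain ⟨t, ht, htK⟩ := hKrec _ hm
        refine ⟨t, hlV ⟨?_, ht.2⟩, ⟨hm.1.trans ht.1, ht.2⟩, htK⟩
        have h1 := ht.1
        linarith [le_max_right 0 l, max_lt hpos hl]
      have : (𝓝[<] S ⊓ 𝓟 {t | t ∈ Ico 0 S ∧ lift t t ∈ K}).NeBot :=
        Filter.frequently_mem_iff_neBot.1 hfreq
      set G := 𝓝[<] S ⊓ 𝓟 {t | t ∈ Ico 0 S ∧ lift t t ∈ K}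
      have hGK : ∀ᶠ t in G, t ∈ Ico 0 S ∧ lift t t ∈ K :=
        Filter.mem_inf_of_right (Filter.mem_principal_self _)
      have hGS : G ≤ 𝓝 S := inf_le_left.trans nhdsWithin_le_nhds
      obtain ⟨z, -, hz⟩ := hK.exists_clusterPt (f := map (fun t => lift t t) G)
        (Filter.le_principal_iff.2 (hGK.mono fun t ht => ht.2))
      have hz' : MapClusterPt z G (fun t => lift t t) := hz
      have hpz : p z = c S := by
        have h1 : MapClusterPt (p z) G (fun t => p (lift t t)) :=
          hz'.continuousAt_comp hp.continuous.continuousAt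
        have h2 : Tendsto (fun t => p (lift t t)) G (𝓝 (c S)) :=
          ((hc.tendsto S).mono_left hGS).congr' (hGK.mono fun t ht =>
            ((hlift t (hmemA t ht.1)).lifts t (right_mem_Icc.2 ht.1.1)).symm)
        exact eq_of_nhds_neBot (NeBot.mono h1 (inf_le_inf_left _ h2))
      obtain ⟨e, hes, rfl⟩ := hp z
      refine ⟨e, rfl, hpz ▸ e.map_source hes, fun V hV => ?_⟩
      have h1 := hz'.frequently (e.open_source.mem_nhds hes)
      have hVG : ∀ᶠ t in G, t ∈ V := hGS hV
      obtain ⟨t, ht, htV, htK⟩ := (h1.and_eventually (hVG.and hGK)).exists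
      exact ⟨t, hmemA t htK.1, htV, htK.1.2.le, ht⟩
  obtain ⟨e, rfl, heS, hkey⟩ := key
  have hV : c ⁻¹' e.target ∈ 𝓝 S := hc.continuousAt (e.open_target.mem_nhds heS)
  obtain ⟨ε, hε, hεV⟩ := Metric.mem_nhds_iff.1 hV
  obtain ⟨a, haA, haV, haS, has⟩ := hkey _ (Metric.ball_mem_nhds S hε)
  have hext : ∀ b < S + ε, ∃ γ', IsLiftOn e c e₀ γ' (Icc 0 b) := fun b hb =>
    (hlift a haA).extend hc haA.1.1 has fun t ht => hεV (by
      rw [Metric.mem_ball, Real.dist_eq, abs_lt] at haV ⊢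
      constructor <;> linarith [ht.1, ht.2, haV.1])
  rcases lt_or_ge 1 (S + ε) with h | h
  · exact hext 1 h
  · have : S + ε / 2 ∈ A := ⟨⟨by linarith, by linarith⟩, hext _ (by linarith)⟩
    linarith [le_csSup hbdd this]

end RayLifting

/-- A continuous map `φ` with `F ∘ φ = c` is differentiable wherever `F` has nonzero derivative. -/
theorem hasDerivAt_of_comp_eventuallyEq {𝕜 : Type*} [NontriviallyNormedField 𝕜]
    [NormedAlgebra 𝕜 ℂ] {F : ℂ → ℂ} {φ c : 𝕜 → ℂ} {x : 𝕜} {F' c' : ℂ} (hφ : ContinuousAt φ x)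
    (hF : HasStrictDerivAt F F' (φ x)) (hF' : F' ≠ 0) (hc : HasDerivAt c c' x)
    (h : F ∘ φ =ᶠ[𝓝 x] c) : HasDerivAt φ (F'⁻¹ * c') x := by
  have hloc : HasDerivAt (hF.localInverse F F' (φ x) hF') F'⁻¹ (c x) := by
    rw [← h.eq_of_nhds]
    exact (hF.to_localInverse hF').hasDerivAt
  refine (hloc.comp x hc).congr_of_eventuallyEq ?_
  filter_upwards [h, hφ.eventually (hF.eventually_left_inverse hF')] with y hy hy'
  rw [Function.comp_apply, ← hy, Function.comp_apply, hy']

theorem isLocalHomeomorph_comp_subtype_val {U : Set ℂ} (hU : IsOpen U) {F F' : ℂ → ℂ}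
    (hF : ∀ z ∈ U, HasStrictDerivAt F (F' z) z) (hF' : ∀ z ∈ U, F' z ≠ 0) :
    IsLocalHomeomorph fun z : U => F z := by
  have hlocal : IsLocalHomeomorphOn F U := fun z hz =>
    let h := (hF z hz).hasStrictFDerivAt_equiv (hF' z hz)
    ⟨h.toOpenPartialHomeomorph F, h.mem_toOpenPartialHomeomorph_source, rfl⟩
  rw [isLocalHomeomorph_iff_isLocalHomeomorphOn_univ]
  exact hlocal.comp hU.isOpenEmbedding_subtypeVal.isLocalHomeomorph.isLocalHomeomorphOn
    fun z _ => z.2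

/-- If every divergent path of `U` issuing from `0` has `lam`-length at least `C * s`, where
`lam ≤ C * |F'|`, then the locally biholomorphic map `F` has a holomorphic inverse on the disk of
radius `s`. -/
theorem exists_inverse_on_ball {U : Set ℂ} (hU : IsOpen U) (h0 : (0 : ℂ) ∈ U) {F F' : ℂ → ℂ}
    (hF : ∀ z ∈ U, HasStrictDerivAt F (F' z) z) (hF' : ∀ z ∈ U, F' z ≠ 0) (hF0 : F 0 = 0)
    {lam : ℂ → ℝ} {C s : ℝ} (hC : 0 < C) (hs : 0 < s) (hlam : ∀ z ∈ U, lam z ≤ C * ‖F' z‖)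
    (hdist : ENNReal.ofReal (C * s) ≤ distToBdry lam U 0) :
    ∃ φ : ℂ → ℂ, DifferentiableOn ℂ φ (Metric.ball 0 s) ∧ MapsTo φ (Metric.ball 0 s) U ∧
      φ 0 = 0 ∧ HasDerivAt φ (F' 0)⁻¹ 0 := by
  set p : U → ℂ := fun z => F z with hp_def
  have hp : IsLocalHomeomorph p := isLocalHomeomorph_comp_subtype_val hU hF hF'
  have hsep : IsSeparatedMap p := T2Space.isSeparatedMap p
  have hray : ∀ w : Metric.ball (0 : ℂ) s,
      ∃ γ, IsLiftOn p (fun t : ℝ => (t : ℂ) * w) (⟨0, h0⟩ : U) γ (Icc 0 1) := by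
    rintro ⟨w, hw⟩
    rw [mem_ball_zero_iff] at hw
    refine exists_isLiftOn_Icc hp hsep (by fun_prop) (by simp [hp_def, hF0]) ?_
    intro T hT γ hγ
    by_contra! hdiv
    have hTt : ∀ t ∈ Ico (0 : ℝ) 1, T * t ∈ Ico 0 T := fun t ht =>
      ⟨mul_nonneg hT.1.le ht.1, by nlinarith [hT.1, ht.2]⟩
    have hder : ∀ t ∈ Ioo (0 : ℝ) 1,
        HasDerivAt (fun t : ℝ => (γ (T * t) : ℂ)) ((F' (γ (T * t)))⁻¹ * (T * w)) t := by
      intro t ht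
      have hnhds : ∀ᶠ x in 𝓝 t, x ∈ Ioo (0 : ℝ) 1 := isOpen_Ioo.mem_nhds ht
      have hcont : ContinuousAt (fun t : ℝ => (γ (T * t) : ℂ)) t := by
        refine continuous_subtype_val.continuousAt.comp ?_
        have h1 : ContinuousAt γ (T * t) := by
          refine (hγ.cont.mono Ioo_subset_Ico_self).continuousAt (isOpen_Ioo.mem_nhds ?_)
          exact ⟨mul_pos hT.1 ht.1, (hTt t (Ioo_subset_Ico_self ht)).2⟩
        exact ContinuousAt.comp (f := fun t => T * t) h1 (by fun_prop)
      refine hasDerivAt_of_comp_eventuallyEq (c := fun t : ℝ => (t : ℂ) * (T * w)) hcont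
        (hF _ (γ (T * t)).2) (hF' _ (γ (T * t)).2) ?_ ?_
      · simpa using (Complex.ofRealCLM.hasDerivAt (x := t)).mul_const ((T : ℂ) * w)
      · filter_upwards [hnhds] with x hx
        have := hγ.lifts _ (hTt x (Ioo_subset_Ico_self hx))
        simp only [hp_def] at this
        simp only [Function.comp_apply, this]
        push_cast
        ring
    let δ : DivergentPath U 0 :=
      { toFun := fun t => γ (T * t)
        start := by simp [hγ.start]
        mem := fun t _ => (γ (T * t)).2
        cont := continuous_subtype_val.comp_continuousOn
          (hγ.cont.comp (by fun_prop) hTt)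
        diff := fun t ht => (hder t ht).differentiableAt
        divergent := fun K hK hKU => by
          obtain ⟨t₀, ht₀, h⟩ := hdiv (Subtype.val ⁻¹' K)
            (Subtype.isCompact_iff.2 (by rwa [Subtype.image_preimage_coe, inter_eq_right.2 hKU]))
          refine ⟨t₀ / T, ⟨div_nonneg ht₀.1 hT.1.le, (div_lt_one hT.1).2 ht₀.2⟩, fun t ht ht1 => ?_⟩
          rw [div_le_iff₀' hT.1] at ht
          exact h _ ⟨ht, by nlinarith [hT.1]⟩ }
    have hlen : pathLen lam δ.toFun ≤ ENNReal.ofReal (C * ‖w‖) := by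
      calc pathLen lam δ.toFun
          ≤ ∫⁻ _ in Ioo (0 : ℝ) 1, ENNReal.ofReal (C * ‖w‖) := by
            refine setLIntegral_mono' measurableSet_Ioo fun t ht => ENNReal.ofReal_le_ofReal ?_
            have hd : deriv δ.toFun t = _ := (hder t ht).deriv
            have hpos : 0 < ‖F' (γ (T * t))‖ := norm_pos_iff.2 (hF' _ (γ (T * t)).2)
            rw [hd, norm_mul, norm_inv, norm_mul, Complex.norm_real, Real.norm_of_nonneg hT.1.le]
            calc lam (γ (T * t)) * (‖F' (γ (T * t))‖⁻¹ * (T * ‖w‖))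
                ≤ (C * ‖F' (γ (T * t))‖) * (‖F' (γ (T * t))‖⁻¹ * (T * ‖w‖)) := by
                  have := hT.1
                  gcongr
                  exact hlam _ (γ (T * t)).2
              _ = T * (C * ‖w‖) := by field_simp
              _ ≤ C * ‖w‖ := mul_le_of_le_one_left (by positivity) hT.2
        _ = ENNReal.ofReal (C * ‖w‖) := by simp
    have hlt : ENNReal.ofReal (C * ‖w‖) < ENNReal.ofReal (C * s) :=
      (ENNReal.ofReal_lt_ofReal_iff (by positivity)).2 (by gcongr)
    exact absurd (hdist.trans ((iInf_le _ δ).trans hlen)) (not_le.2 hlt)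
  choose Γ hΓ using hray
  have hcont : Continuous fun x : unitInterval × Metric.ball (0 : ℂ) s => Γ x.2 x.1 := by
    refine hp.continuous_lift hsep
      ⟨fun x : unitInterval × Metric.ball (0 : ℂ) s => ((x.1 : ℝ) : ℂ) * x.2, by fun_prop⟩
      ?_ ?_ fun w => ?_
    · ext x
      exact (hΓ x.2).lifts _ x.1.2
    · simp only [Icc.coe_zero, (hΓ _).start]
      exact continuous_const
    · exact (hΓ w).cont.comp_continuous continuous_subtype_val fun t => t.2
  classical
  set φ : ℂ → ℂ := fun w => if h : w ∈ Metric.ball (0 : ℂ) s then Γ ⟨w, h⟩ 1 else 0 with hφ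
  have hφeq : ∀ w (h : w ∈ Metric.ball (0 : ℂ) s), φ w = Γ ⟨w, h⟩ 1 := fun w h => by
    simp only [hφ, dif_pos h]
  have hφcont : ContinuousOn φ (Metric.ball 0 s) := by
    rw [continuousOn_iff_continuous_domRestrict]
    have : Continuous fun w : Metric.ball (0 : ℂ) s => (Γ w 1 : ℂ) :=
      continuous_subtype_val.comp (hcont.comp (Continuous.prodMk_right (1 : unitInterval)))
    exact this.congr fun w => (hφeq w w.2).symm
  have hφU : MapsTo φ (Metric.ball 0 s) U := fun w hw => by
    rw [hφeq w hw]
    exact (Γ ⟨w, hw⟩ 1).2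
  have hFφ : ∀ w ∈ Metric.ball (0 : ℂ) s, F (φ w) = w := fun w hw => by
    have := (hΓ ⟨w, hw⟩).lifts 1 (by simp)
    rw [hφeq w hw]
    simpa [hp_def] using this
  have hder : ∀ w ∈ Metric.ball (0 : ℂ) s, HasDerivAt φ (F' (φ w))⁻¹ w := fun w hw => by
    have hnhds := Metric.isOpen_ball.mem_nhds hw
    simpa using hasDerivAt_of_comp_eventuallyEq (c := id) (hφcont.continuousAt hnhds)
      (hF _ (hφU hw)) (hF' _ (hφU hw)) (hasDerivAt_id w)
      (by filter_upwards [hnhds] with x hx using hFφ x hx)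
  have hb0 : (0 : ℂ) ∈ Metric.ball (0 : ℂ) s := by simpa using hs
  have hφ0 : φ 0 = 0 := by
    rw [hφeq 0 hb0]
    have h := hΓ ⟨0, hb0⟩
    rw [hsep.constOn_of_comp hp.isLocallyInjective isPreconnected_Icc h.cont (a := 1) (a' := 0)
      (fun a ha a' ha' => by rw [h.lifts a ha, h.lifts a' ha']; simp) (by simp) (by simp), h.start]
  refine ⟨φ, fun w hw => (hder w hw).differentiableAt.differentiableWithinAt, hφU, hφ0, ?_⟩
  simpa only [hφ0] using hder 0 hb0

/-- The spherical derivative of a finite-valued map is at most the modulus of its derivative. -/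
theorem sphD_coe_le {g : ℂ → OnePoint ℂ} {h : ℂ → ℂ} {z h' : ℂ}
    (hg : ∀ᶠ w in 𝓝 z, g w = (h w : OnePoint ℂ)) (hh : HasDerivAt h h' z) :
    0 ≤ sphD g z ∧ sphD g z ≤ ‖h'‖ := by
  have hlim : Tendsto (fun w => sphDist (g w) (g z) / ‖w - z‖) (𝓝[≠] z)
      (𝓝 (‖h'‖ / (Real.sqrt (1 + ‖h z‖ ^ 2) * Real.sqrt (1 + ‖h z‖ ^ 2)))) := by
    have h1 : Tendsto (fun w => ‖slope h z w‖ /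
        (Real.sqrt (1 + ‖h w‖ ^ 2) * Real.sqrt (1 + ‖h z‖ ^ 2))) (𝓝[≠] z)
        (𝓝 (‖h'‖ / (Real.sqrt (1 + ‖h z‖ ^ 2) * Real.sqrt (1 + ‖h z‖ ^ 2)))) := by
      refine hh.tendsto_slope.norm.div ?_ (by positivity)
      refine Tendsto.mono_left ?_ nhdsWithin_le_nhds
      have := hh.continuousAt
      exact ContinuousAt.tendsto
        (f := fun w => Real.sqrt (1 + ‖h w‖ ^ 2) * Real.sqrt (1 + ‖h z‖ ^ 2)) (by fun_prop)
    refine h1.congr' ?_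
    filter_upwards [nhdsWithin_le_nhds hg] with w hw
    rw [hw, hg.self_of_nhds, slope_def_field, norm_div]
    change _ = ‖h w - h z‖ / _ / _
    rw [div_right_comm]
  have heq : sphD g z = ‖h'‖ / (1 + ‖h z‖ ^ 2) := by
    rw [sphD, hlim.limUnder_eq, Real.mul_self_sqrt (by positivity)]
  rw [heq]
  exact ⟨by positivity, div_le_self (norm_nonneg _) (by nlinarith [sq_nonneg ‖h z‖])⟩

/-- A finite-valued spherically holomorphic map is a holomorphic function. -/
theorem SphHolomorphicOn.differentiableOn {g : ℂ → OnePoint ℂ} {h : ℂ → ℂ} {U : Set ℂ}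
    (hU : IsOpen U) (hg : SphHolomorphicOn g U) (hgh : ∀ z ∈ U, g z = (h z : OnePoint ℂ)) :
    DifferentiableOn ℂ h U := by
  intro z hz
  obtain ⟨V, hV, hzV, k, hk, hgk⟩ := hg z hz
  have hkz : DifferentiableAt ℂ k z := hk.differentiableAt (hV.mem_nhds hzV)
  have hnhds : ∀ᶠ w in 𝓝 z, w ∈ U ∩ V := (hU.inter hV).mem_nhds ⟨hz, hzV⟩
  refine DifferentiableAt.differentiableWithinAt ?_
  rcases hgk with hgk | hgk
  · refine hkz.congr_of_eventuallyEq ?_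
    filter_upwards [hnhds] with w hw
    exact OnePoint.coe_injective ((hgh w hw.1).symm.trans (hgk w hw.2))
  · have hne : ∀ w ∈ U ∩ V, k w ≠ 0 ∧ h w = (k w)⁻¹ := fun w hw => by
      have := (hgh w hw.1).symm.trans (hgk w hw.2)
      split_ifs at this with h0
      · exact absurd this (OnePoint.coe_ne_infty _)
      · exact ⟨h0, OnePoint.coe_injective this⟩
    refine (hkz.inv (hne z ⟨hz, hzV⟩).1).congr_of_eventuallyEq ?_
    filter_upwards [hnhds] with w hw
    exact (hne w hw).2

/-- Cauchy's estimate on an open disk. -/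
theorem norm_le_div_of_hasDerivAt_of_norm_le_ball {k : ℂ → ℂ} {k' : ℂ} {s L : ℝ} (hs : 0 < s)
    (hk : DifferentiableOn ℂ k (Metric.ball 0 s)) (hk' : HasDerivAt k k' 0)
    (hL : ∀ z ∈ Metric.ball (0 : ℂ) s, ‖k z‖ ≤ L) : ‖k'‖ ≤ L / s := by
  have hlim : Tendsto (fun t => L / t) (𝓝[<] s) (𝓝 (L / s)) :=
    (tendsto_const_nhds.div tendsto_id hs.ne').mono_left nhdsWithin_le_nhds
  refine ge_of_tendsto hlim ?_
  filter_upwards [Ioo_mem_nhdsLT hs] with t ht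
  rw [← hk'.deriv]
  have hsub : Metric.closedBall (0 : ℂ) t ⊆ Metric.ball 0 s := Metric.closedBall_subset_ball ht.2
  refine Complex.norm_deriv_le_of_forall_mem_sphere_norm_le ht.1
    ((hk.mono ?_).diffContOnCl) fun z hz => hL z (hsub (Metric.sphere_subset_closedBall hz))
  rwa [closure_ball _ ht.1.ne']

theorem WeierstrassTriple.sqrt_abs_curv {m : ℕ} {U : Set ℂ} (T : WeierstrassTriple m U) {z : ℂ}
    (hz : z ∈ U) (h : 0 ≤ sphD T.g z) :
    Real.sqrt |T.curv z| = Real.sqrt (2 * m) * (sphD T.g z / T.lam z) := by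
  have hl := T.lam_pos z hz
  have : |T.curv z| = 2 * m * (sphD T.g z / T.lam z) ^ 2 := by
    rw [WeierstrassTriple.curv, neg_mul, neg_div, abs_neg, abs_of_nonneg (by positivity)]
    ring
  rw [this, Real.sqrt_mul (by positivity), Real.sqrt_sq (by positivity)]

/-- Pointwise curvature estimate at the center: with `C = √(2m)·L·(1+L²)^{m/2}`, every
Weierstrass `m`-triple on a disk `D(0;R)` with `|g| < L` satisfies
`|K(0)|^{1/2} ≤ C / d(0)`. -/
theorem pointwise_curvature_estimate (L : ℝ) (hL : 0 < L) (m : ℕ) (hm : 0 < m)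
    (R : ℝ) (hR : 0 < R) (T : WeierstrassTriple m (Metric.ball (0:ℂ) R))
    (hbdd : ∀ z ∈ Metric.ball (0:ℂ) R, ∃ w : ℂ, T.g z = (w : OnePoint ℂ) ∧ ‖w‖ < L) :
    ENNReal.ofReal (Real.sqrt |T.curv 0|) * distToBdry T.lam (Metric.ball (0:ℂ) R) 0
      ≤ ENNReal.ofReal (Real.sqrt (2 * m) * L * (1 + L ^ 2) ^ ((m : ℝ) / 2)) := by
  choose! h hgh hhL using hbdd
  have h0 : (0 : ℂ) ∈ Metric.ball (0 : ℂ) R := Metric.mem_ball_self hR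
  have hh : DifferentiableOn ℂ h (Metric.ball (0 : ℂ) R) := T.g_holo.differentiableOn T.isOpen hgh
  have hf : ∀ z ∈ Metric.ball (0 : ℂ) R, T.f z ≠ 0 := fun z hz hfz => by
    have := T.lam_pos z hz
    rw [T.lam_eq z hz _ (hgh z hz), hfz, norm_zero, mul_zero] at this
    exact this.false
  obtain ⟨F, hF0, hF⟩ := (T.f_holo.isExactOn_ball).with_val_at 0 0
  have hFs : ∀ z ∈ Metric.ball (0 : ℂ) R, HasStrictDerivAt F (T.f z) z := fun z hz => by
    have hFd : DifferentiableOn ℂ F (Metric.ball (0 : ℂ) R) := fun w hw =>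
      (hF w hw).differentiableAt.differentiableWithinAt
    rw [← (hF z hz).deriv]
    exact (hFd.analyticAt (T.isOpen.mem_nhds hz)).hasStrictDerivAt
  set C := (1 + L ^ 2) ^ ((m : ℝ) / 2) with hC
  have hCpos : 0 < C := by positivity
  have hlam : ∀ z ∈ Metric.ball (0 : ℂ) R, T.lam z ≤ C * ‖T.f z‖ := fun z hz => by
    rw [T.lam_eq z hz _ (hgh z hz)]
    have := (hhL z hz).le
    rw [hC]
    gcongr
  have hlam0 : ‖T.f 0‖ ≤ T.lam 0 := by
    rw [T.lam_eq 0 h0 _ (hgh 0 h0)]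
    refine le_mul_of_one_le_left (norm_nonneg _) (Real.one_le_rpow ?_ (by positivity))
    nlinarith [sq_nonneg ‖h 0‖]
  have hh0 : HasDerivAt h (deriv h 0) 0 :=
    (hh.differentiableAt (T.isOpen.mem_nhds h0)).hasDerivAt
  obtain ⟨hD0, hD⟩ := sphD_coe_le (eventually_of_mem (T.isOpen.mem_nhds h0) hgh) hh0
  have hf0 : 0 < ‖T.f 0‖ := norm_pos_iff.2 (hf 0 h0)
  have hmain : ∀ s : ℝ, 0 < s →
      ENNReal.ofReal (C * s) ≤ distToBdry T.lam (Metric.ball (0 : ℂ) R) 0 →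
      Real.sqrt |T.curv 0| ≤ Real.sqrt (2 * m) * (L / s) := by
    intro s hs hsd
    obtain ⟨φ, hφ, hφB, hφ0, hφ'⟩ :=
      exists_inverse_on_ball T.isOpen h0 hFs hf hF0 hCpos hs hlam hsd
    have hcomp : HasDerivAt (h ∘ φ) (deriv h 0 * (T.f 0)⁻¹) 0 :=
      HasDerivAt.comp 0 (by rwa [hφ0]) hφ'
    have hle := norm_le_div_of_hasDerivAt_of_norm_le_ball hs (hh.comp hφ hφB) hcomp
      fun z hz => (hhL _ (hφB hz)).le
    rw [T.sqrt_abs_curv h0 hD0]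
    refine mul_le_mul_of_nonneg_left (le_trans ?_ hle) (Real.sqrt_nonneg _)
    rw [norm_mul, norm_inv, ← div_eq_mul_inv]
    gcongr
  rcases (Real.sqrt_nonneg |T.curv 0|).eq_or_lt with hK | hK
  · simp [← hK]
  rw [mul_comm, ← ENNReal.le_div_iff_mul_le (by simp [hK]) (by simp),
    ← ENNReal.ofReal_div_of_pos hK]
  by_contra! hlt
  obtain ⟨r, -, hr, hrd⟩ := ENNReal.lt_iff_exists_real_btwn.1 hlt
  have hr' := (ENNReal.ofReal_lt_ofReal_iff_of_nonneg (by positivity)).1 hr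
  have hrpos : 0 < r := lt_of_le_of_lt (by positivity) hr'
  have hle := hmain (r / C) (by positivity) (by rw [mul_div_cancel₀ _ hCpos.ne']; exact hrd.le)
  rw [div_div_eq_mul_div, ← mul_div_assoc, ← mul_assoc, le_div_iff₀ hrpos] at hle
  rw [div_lt_iff₀ hK] at hr'
  linarith

end
end
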